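/- arXiv:math/9501224 — 4 statements merged into one kernel-verified Lean document; each statement's English description precedes it below -/
import Mathlib

section
/- Let n ≥ 1 and let a₀, a₁, …, aₙ be independent standard normal real random variables. Then the expected number of real zeros of the random polynomial p(x) = a₀ + a₁x + ⋯ + aₙxⁿ equals (1/π) ∫_ℝ √( 1/(t²−1)² − (n+1)²·t^(2n)/(t^(2n+2)−1)² ) dt. (Kac formula, Theorem 2.1.) -/
open MeasureTheory ProbabilityTheory Real Set
open scoped ENNReal NNReal

/-- A `C¹` function on `ℝ` is injective on each piece of a countable measurable partition of the
complement of its critical set. -/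
theorem exists_countable_cover_injOn {f f' : ℝ → ℝ} (hf : ∀ x, HasDerivAt f (f' x) x)
    (hf' : Continuous f') :
    ∃ s : ℕ → Set ℝ, (∀ k, MeasurableSet (s k)) ∧ Pairwise (Function.onFun Disjoint s) ∧
      (∀ k, InjOn f (s k)) ∧ ⋃ k, s k = {x | f' x ≠ 0} := by
  have hU : IsOpen {x | f' x ≠ 0} := isOpen_ne_fun hf' continuous_const
  have hloc : ∀ x ∈ {x | f' x ≠ 0}, ∃ r > 0, InjOn f (Metric.ball x r) := by
    intro x hx
    obtain ⟨r, hr, hball⟩ := Metric.isOpen_iff.1 hU x hx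
    refine ⟨r, hr, ?_⟩
    have hconv : Convex ℝ (Metric.ball x r) := convex_ball x r
    have hcont : ContinuousOn f (Metric.ball x r) :=
      fun y _ ↦ (hf y).continuousAt.continuousWithinAt
    intro y hy z hz hyz
    by_contra hne
    wlog hlt : y < z generalizing y z
    · exact this hz hy hyz.symm (Ne.symm hne) (lt_of_le_of_ne (not_lt.1 hlt) (Ne.symm hne))
    have hsub : Icc y z ⊆ Metric.ball x r := hconv.ordConnected.out hy hz
    obtain ⟨c, hc, hc0⟩ := exists_hasDerivAt_eq_zero hlt (hcont.mono hsub) hyz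
      (fun w _ ↦ hf w)
    exact hball (hsub (Ioo_subset_Icc_self hc)) hc0
  choose! r hr hinj using hloc
  obtain ⟨t, ht, htc, htU⟩ := TopologicalSpace.countable_cover_nhdsWithin
    (s := {x | f' x ≠ 0}) (f := fun x ↦ Metric.ball x (r x))
    (fun x hx ↦ mem_nhdsWithin_of_mem_nhds (Metric.ball_mem_nhds x (hr x hx)))
  have hex : ∃ b : ℕ → Set ℝ, (∀ k, MeasurableSet (b k)) ∧ (∀ k, InjOn f (b k)) ∧
      {x | f' x ≠ 0} ⊆ ⋃ k, b k := by
    rcases t.eq_empty_or_nonempty with rfl | hne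
    · exact ⟨fun _ ↦ ∅, by simp, by simp, by simpa using htU⟩
    · obtain ⟨e, rfl⟩ := htc.exists_eq_range hne
      refine ⟨fun k ↦ Metric.ball (e k) (r (e k)), fun k ↦ measurableSet_ball,
        fun k ↦ hinj _ (ht ⟨k, rfl⟩), by simpa using htU⟩
  obtain ⟨b, hbm, hbi, hbU⟩ := hex
  refine ⟨fun k ↦ disjointed b k ∩ {x | f' x ≠ 0},
    fun k ↦ (MeasurableSet.disjointed hbm k).inter hU.measurableSet,
    fun i j hij ↦ (disjoint_disjointed b hij).mono inter_subset_left inter_subset_left,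
    fun k ↦ (hbi k).mono (inter_subset_left.trans (disjointed_subset b k)), ?_⟩
  rw [← iUnion_inter, iUnion_disjointed, inter_eq_right]
  exact hbU

/-- The **area formula** in dimension one, with multiplicity. -/
theorem lintegral_mul_encard_fiber {f f' : ℝ → ℝ} (hf : ∀ x, HasDerivAt f (f' x) x)
    (hf' : Continuous f') {g : ℝ → ℝ≥0∞} (hg : Measurable g) :
    ∫⁻ y, g y * ({x | f x = y}.encard : ℝ≥0∞) = ∫⁻ x, ENNReal.ofReal |f' x| * g (f x) := by
  obtain ⟨s, hsm, hsd, hsi, hsU⟩ := exists_countable_cover_injOn hf hf'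
  have hfc : Continuous f := continuous_iff_continuousAt.2 fun x ↦ (hf x).continuousAt
  have himg : ∀ k, MeasurableSet (f '' s k) := fun k ↦
    (hsm k).image_of_continuousOn_injOn hfc.continuousOn (hsi k)
  have hcrit : volume (f '' {x | f' x = 0}) = 0 := by
    refine addHaar_image_eq_zero_of_det_fderivWithin_eq_zero volume
      (f' := fun x ↦ ContinuousLinearMap.toSpanSingleton ℝ (f' x))
      (fun x _ ↦ (hf x).hasFDerivAt.hasFDerivWithinAt) ?_
    intro x hx
    simpa [ContinuousLinearMap.det, ContinuousLinearMap.toSpanSingleton] using hx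
  have hcount : ∀ y, y ∉ f '' {x | f' x = 0} →
      ({x | f x = y}.encard : ℝ≥0∞) = ∑' k, (f '' s k).indicator 1 y := by
    intro y hy
    have hfib : MeasurableSet {x | f x = y} := (isClosed_eq hfc continuous_const).measurableSet
    have hdec : {x | f x = y} = ⋃ k, {x | f x = y} ∩ s k := by
      rw [← inter_iUnion, hsU, eq_comm, inter_eq_left]
      exact fun x hx h0 ↦ hy ⟨x, h0, hx⟩
    rw [← Measure.count_apply hfib, hdec, measure_iUnion
      (fun i j hij ↦ (hsd hij).mono inter_subset_right inter_subset_right)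
      (fun k ↦ hfib.inter (hsm k))]
    refine tsum_congr fun k ↦ ?_
    by_cases hk : y ∈ f '' s k
    · obtain ⟨x, hx, rfl⟩ := hk
      have : {z | f z = f x} ∩ s k = {x} := by
        ext z
        exact ⟨fun h ↦ hsi k h.2 hx h.1, fun h ↦ by rw [h]; exact ⟨rfl, hx⟩⟩
      rw [this, indicator_of_mem (mem_image_of_mem f hx)]
      simp
    · have : {z | f z = y} ∩ s k = ∅ := by
        ext z
        exact ⟨fun h ↦ hk ⟨z, h.2, h.1⟩, fun h ↦ h.elim⟩
      rw [this, indicator_of_notMem hk, measure_empty]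
  have hae : ∀ᵐ y, g y * ({x | f x = y}.encard : ℝ≥0∞) =
      ∑' k, (f '' s k).indicator g y := by
    filter_upwards [measure_eq_zero_iff_ae_notMem.1 hcrit] with y hy
    rw [hcount y hy, ← ENNReal.tsum_mul_left]
    refine tsum_congr fun k ↦ ?_
    by_cases hk : y ∈ f '' s k <;> simp [hk]
  rw [lintegral_congr_ae hae, lintegral_tsum fun k ↦ (hg.indicator (himg k)).aemeasurable]
  simp_rw [lintegral_indicator (himg _)]
  have hcv : ∀ k, ∫⁻ y in f '' s k, g y = ∫⁻ x in s k, ENNReal.ofReal |f' x| * g (f x) := fun k ↦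
    lintegral_image_eq_lintegral_abs_deriv_mul (hsm k) (fun x _ ↦ (hf x).hasDerivWithinAt)
      (hsi k) g
  simp_rw [hcv]
  rw [← lintegral_iUnion hsm hsd, hsU]
  refine setLIntegral_eq_of_support_subset fun x hx h0 ↦ hx ?_
  simp [show f' x = 0 from h0]

/-- The number of zeros of a function depending continuously on a parameter is a measurable
function of the parameter. -/
theorem measurable_encard_fiber {X : Type*} [TopologicalSpace X] [T2Space X]
    [SecondCountableTopology X] [LocallyCompactSpace X] [MeasurableSpace X] [BorelSpace X]
    {F : X → ℝ → ℝ} (hF : Continuous (Function.uncurry F)) :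
    Measurable fun a ↦ ({t | F a t = 0}.encard : ℝ≥0∞) := by
  have hlev : ∀ k : ℕ, MeasurableSet {a | (k : ℕ∞) ≤ {t | F a t = 0}.encard} := by
    intro k
    let G : Set (X × (Fin k → ℝ)) :=
      {p | ∀ i, F p.1 (p.2 i) = 0} ∩ {p | Function.Injective p.2}
    have hclosed : IsClosed {p : X × (Fin k → ℝ) | ∀ i, F p.1 (p.2 i) = 0} := by
      simp only [ofPred_forall]
      refine isClosed_iInter fun i ↦ isClosed_eq ?_ continuous_const
      exact hF.comp (continuous_fst.prodMk ((continuous_apply i).comp continuous_snd))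
    have hopen : IsOpen {p : X × (Fin k → ℝ) | Function.Injective p.2} := by
      have : {p : X × (Fin k → ℝ) | Function.Injective p.2} =
          ⋂ i, ⋂ j, {p | i ≠ j → p.2 i ≠ p.2 j} := by
        ext p
        simp only [mem_ofPred_eq, mem_iInter, Function.Injective]
        exact forall₂_congr fun i j ↦ not_imp_not.symm
      rw [this]
      refine isOpen_iInter_of_finite fun i ↦ isOpen_iInter_of_finite fun j ↦ ?_
      by_cases hij : i = j
      · simp [hij]
      · simp only [ne_eq, hij, not_false_eq_true, forall_const]
        exact isOpen_ne_fun (by fun_prop) (by fun_prop)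
    have hG : IsSigmaCompact G := by
      have : LocallyCompactSpace G :=
        (hclosed.isLocallyClosed.inter hopen.isLocallyClosed).locallyCompactSpace
      exact isSigmaCompact_iff_sigmaCompactSpace.2 inferInstance
    have hproj : {a | (k : ℕ∞) ≤ {t | F a t = 0}.encard} = Prod.fst '' G := by
      ext a
      constructor
      · intro h
        obtain ⟨u, hu, hcard⟩ := exists_subset_encard_eq h
        have hfin : u.Finite := finite_of_encard_eq_coe hcard
        have hc : hfin.toFinset.card = k := by
          rw [hfin.encard_eq_coe_toFinset_card] at hcard
          exact_mod_cast hcard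
        refine ⟨(a, fun i ↦ hfin.toFinset.equivFinOfCardEq hc |>.symm i), ⟨fun i ↦ ?_, ?_⟩, rfl⟩
        · exact hu (hfin.mem_toFinset.1 (Subtype.prop _))
        · exact Subtype.val_injective.comp (Equiv.injective _)
      · rintro ⟨⟨a', t⟩, ⟨h0, hinj⟩, rfl⟩
        have : range t ⊆ {t | F a' t = 0} := by rintro _ ⟨i, rfl⟩; exact h0 i
        refine le_trans ?_ (encard_le_encard this)
        rw [← image_univ, hinj.encard_image]
        simp
    rw [hproj]
    obtain ⟨K, hK, hKU⟩ := hG.image continuous_fst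
    rw [← hKU]
    exact MeasurableSet.iUnion fun i ↦ (hK i).measurableSet
  have hmeas : Measurable fun a ↦ {t | F a t = 0}.encard := by
    refine ENat.measurable_iff.2 fun k ↦ ?_
    have : (fun a ↦ {t | F a t = 0}.encard) ⁻¹' {(k : ℕ∞)} =
        {a | (k : ℕ∞) ≤ {t | F a t = 0}.encard} \
          {a | ((k + 1 : ℕ) : ℕ∞) ≤ {t | F a t = 0}.encard} := by
      ext a
      simp only [mem_preimage, mem_singleton_iff, mem_sdiff, mem_ofPred_eq, Nat.cast_add,
        Nat.cast_one, ENat.add_one_le_iff (ENat.natCast_ne_top k), not_lt]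
      exact ⟨fun h ↦ ⟨h.ge, h.le⟩, fun h ↦ le_antisymm h.2 h.1⟩
    rw [this]
    exact MeasurableSet.diff (hlev k) (hlev (k + 1))
  exact (measurable_from_top (f := ((↑) : ℕ∞ → ℝ≥0∞))).comp hmeas

/-- The first absolute moment of a centered Gaussian. -/
theorem lintegral_abs_gaussianReal (v : ℝ≥0) :
    ∫⁻ x, ENNReal.ofReal |x| ∂(gaussianReal 0 v) = ENNReal.ofReal (√(2 * v / π)) := by
  have hstd : ∫⁻ x, ENNReal.ofReal |x| ∂(gaussianReal 0 1) = ENNReal.ofReal (√(2 / π)) := by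
    rw [← ofReal_integral_eq_lintegral_ofReal _ (ae_of_all _ fun x ↦ abs_nonneg x)]
    · congr 1
      rw [integral_gaussianReal_eq_integral_smul one_ne_zero]
      have h1 : ∀ x : ℝ, gaussianPDFReal 0 1 x • |x| =
          (fun y : ℝ ↦ (√(2 * π))⁻¹ * (y ^ (1 : ℝ) * exp (-(1 / 2) * y ^ (2 : ℝ)))) |x| := by
        intro x
        simp only [gaussianPDFReal, NNReal.coe_one, mul_one, sub_zero, smul_eq_mul, rpow_one,
          rpow_two, sq_abs]
        ring_nf
      simp_rw [h1]
      rw [integral_comp_abs (f := fun y : ℝ ↦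
        (√(2 * π))⁻¹ * (y ^ (1 : ℝ) * exp (-(1 / 2) * y ^ (2 : ℝ)))), integral_const_mul,
        integral_rpow_mul_exp_neg_mul_rpow (by norm_num) (by norm_num) (by norm_num)]
      norm_num
      rw [← sq_eq_sq₀ (by positivity) (by positivity)]
      field_simp
      norm_num [show √2 ^ 4 = (√2 ^ 2) ^ 2 by ring]
    · exact ((memLp_id_gaussianReal 1).integrable (by simp)).abs
  have hmap : gaussianReal 0 v = (gaussianReal 0 1).map (fun x ↦ √v * x) := by
    rw [gaussianReal_map_const_mul]
    congr 1
    · simp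
    · ext; simp
  rw [hmap, lintegral_map (by fun_prop) (by fun_prop)]
  simp_rw [abs_mul, abs_of_nonneg (sqrt_nonneg _), ENNReal.ofReal_mul (sqrt_nonneg _)]
  rw [lintegral_const_mul _ (by fun_prop), hstd, ← ENNReal.ofReal_mul (sqrt_nonneg _),
    ← sqrt_mul (by positivity)]
  congr 2
  ring

variable {ι : Type*} [Fintype ι]

theorem hasGaussianLaw_pi_gaussianReal :
    HasGaussianLaw (fun b : ι → ℝ ↦ b) (Measure.pi fun _ : ι ↦ gaussianReal 0 1) := by
  refine iIndepFun.hasGaussianLaw (X := fun i (b : ι → ℝ) ↦ b i) (fun i ↦ ?_)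
    (iIndepFun_pi (μ := fun _ : ι ↦ gaussianReal 0 1) (X := fun _ x ↦ x) (by fun_prop))
  exact HasLaw.hasGaussianLaw
    ⟨(measurable_pi_apply i).aemeasurable,
      (measurePreserving_eval (fun _ : ι ↦ gaussianReal 0 1) i).map_eq⟩

theorem hasGaussianLaw_pi_linear (c d : ι → ℝ) :
    HasGaussianLaw (fun b : ι → ℝ ↦ (∑ i, c i * b i, ∑ i, d i * b i))
      (Measure.pi fun _ ↦ gaussianReal 0 1) := by
  let L : (ι → ℝ) →L[ℝ] ℝ × ℝ :=
    (∑ i, c i • ContinuousLinearMap.proj i).prod (∑ i, d i • ContinuousLinearMap.proj i)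
  have := hasGaussianLaw_pi_gaussianReal.map_fun L
  have hL : (fun b ↦ L b) = fun b : ι → ℝ ↦ (∑ i, c i * b i, ∑ i, d i * b i) := by
    ext b <;> simp [L]
  rwa [hL] at this

theorem covariance_pi_linear (c d : ι → ℝ) :
    cov[fun b : ι → ℝ ↦ ∑ i, c i * b i, fun b : ι → ℝ ↦ ∑ i, d i * b i;
      Measure.pi fun _ ↦ gaussianReal 0 1] = ∑ i, c i * d i := by
  classical
  have hev : ∀ i, MemLp (fun b : ι → ℝ ↦ b i) 2 (Measure.pi fun _ : ι ↦ gaussianReal 0 1) :=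
    fun i ↦ (hasGaussianLaw_pi_gaussianReal.eval i).memLp_two
  have hcov : ∀ i j, cov[fun b : ι → ℝ ↦ b i, fun b : ι → ℝ ↦ b j;
      Measure.pi fun _ ↦ gaussianReal 0 1] = if i = j then 1 else 0 := by
    intro i j
    split_ifs with h
    · subst h
      rw [covariance_self (measurable_pi_apply i).aemeasurable]
      have := variance_map (μ := Measure.pi fun _ : ι ↦ gaussianReal 0 1) (X := id)
        (Y := fun b : ι → ℝ ↦ b i) aemeasurable_id (measurable_pi_apply i).aemeasurable
      rw [(measurePreserving_eval _ i).map_eq, variance_id_gaussianReal] at this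
      simpa [Function.comp_def] using this.symm
    · have hind := iIndepFun_pi (μ := fun _ : ι ↦ gaussianReal 0 1) (X := fun _ x ↦ x)
        (by fun_prop)
      exact (hind.indepFun h).covariance_eq_zero (hev i) (hev j)
  rw [covariance_fun_sum_fun_sum (fun i ↦ (hev i).const_mul _) (fun i ↦ (hev i).const_mul _)]
  simp_rw [covariance_const_mul_left, covariance_const_mul_right, hcov]
  simp

theorem map_pi_linear (c : ι → ℝ) :
    (Measure.pi fun _ : ι ↦ gaussianReal 0 1).map (fun b ↦ ∑ i, c i * b i) =
      gaussianReal 0 (∑ i, c i ^ 2).toNNReal := by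
  have hm : Measurable fun b : ι → ℝ ↦ ∑ i, c i * b i := by fun_prop
  rw [(hasGaussianLaw_pi_linear c c).fst.map_eq_gaussianReal, ← covariance_self hm.aemeasurable,
    covariance_pi_linear]
  congr 1
  · rw [integral_finsetSum _ fun i _ ↦
      (hasGaussianLaw_pi_gaussianReal.eval i).integrable.const_mul _]
    refine Finset.sum_eq_zero fun i _ ↦ ?_
    rw [integral_const_mul]
    have := integral_map (μ := Measure.pi fun _ : ι ↦ gaussianReal 0 1) (f := id)
      (measurable_pi_apply i).aemeasurable aestronglyMeasurable_id
    rw [(measurePreserving_eval _ i).map_eq] at this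
    have h0 := integral_id_gaussianReal (μ := 0) (v := 1)
    simp only [id] at this
    rw [← this, h0, mul_zero]
  · simp_rw [sq]

/-- Weighting a centered Gaussian by the standard normal density gives a multiple of a Gaussian. -/
theorem gaussianReal_withDensity_gaussianPDF (A : ℝ≥0) (hA : A ≠ 0) :
    (gaussianReal 0 A).withDensity (gaussianPDF 0 1) =
      ENNReal.ofReal (√(2 * π * (1 + A)))⁻¹ • gaussianReal 0 (A / (1 + A)) := by
  have h1 : A / (1 + A) ≠ 0 := by positivity
  rw [gaussianReal_of_var_ne_zero _ hA, gaussianReal_of_var_ne_zero _ h1,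
    ← withDensity_mul _ (by fun_prop) (by fun_prop), ← withDensity_smul _ (by fun_prop)]
  congr 1
  ext x
  simp only [Pi.mul_apply, Pi.smul_apply, smul_eq_mul, gaussianPDF]
  rw [← ENNReal.ofReal_mul (gaussianPDFReal_nonneg _ _ _), ← ENNReal.ofReal_mul (by positivity)]
  congr 1
  simp only [gaussianPDFReal, NNReal.coe_div, NNReal.coe_add, NNReal.coe_one, sub_zero, mul_one]
  have hA' : (0 : ℝ) < A := by positivity
  have e : -x ^ 2 / (2 * (A / (1 + A) : ℝ)) = -x ^ 2 / (2 * A) + -x ^ 2 / 2 := by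
    field_simp
    ring
  have r : √(2 * π * A) * √(2 * π) = √(2 * π * (1 + A)) * √(2 * π * A / (1 + A)) := by
    rw [← sqrt_mul (by positivity), ← sqrt_mul (by positivity)]
    congr 1
    field_simp
  rw [e, exp_add]
  field_simp
  linear_combination -r

/-- The expectation of `φ(X) |Y|`, where `φ` is the standard normal density and `X`, `Y` are linear
functionals of a standard Gaussian vector. -/
theorem lintegral_gaussianPDF_mul_abs_pi (c d : ι → ℝ) {A B C : ℝ} (hA : ∑ i, c i ^ 2 = A)
    (hB : ∑ i, c i * d i = B) (hC : ∑ i, d i ^ 2 = C) (hA0 : A ≠ 0) :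
    ∫⁻ b : ι → ℝ, gaussianPDF 0 1 (∑ i, c i * b i) * ENNReal.ofReal |∑ i, d i * b i|
        ∂(Measure.pi fun _ ↦ gaussianReal 0 1) =
      ENNReal.ofReal (√(C / (1 + A) - B ^ 2 / (1 + A) ^ 2)) / ENNReal.ofReal π := by
  have hApos : 0 < A := lt_of_le_of_ne (hA ▸ Finset.sum_nonneg fun i _ ↦ sq_nonneg _) hA0.symm
  let e : ι → ℝ := fun i ↦ d i - B / A * c i
  have hE : ∑ i, e i ^ 2 = C - B ^ 2 / A := by
    have : ∀ i, e i ^ 2 = d i ^ 2 - 2 * (B / A) * (c i * d i) + (B / A) ^ 2 * c i ^ 2 := by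
      intro i; simp only [e]; ring
    simp_rw [this]
    rw [Finset.sum_add_distrib, Finset.sum_sub_distrib, ← Finset.mul_sum, ← Finset.mul_sum,
      hA, hB, hC]
    field_simp
    ring
  have hce : ∑ i, c i * e i = 0 := by
    have : ∀ i, c i * e i = c i * d i - B / A * c i ^ 2 := by intro i; simp only [e]; ring
    simp_rw [this]
    rw [Finset.sum_sub_distrib, ← Finset.mul_sum, hA, hB]
    field_simp
    ring
  have hEnn : 0 ≤ C - B ^ 2 / A := hE ▸ Finset.sum_nonneg fun i _ ↦ sq_nonneg _
  have hd : ∀ b : ι → ℝ, ∑ i, d i * b i = ∑ i, e i * b i + B / A * ∑ i, c i * b i := by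
    intro b
    rw [Finset.mul_sum, ← Finset.sum_add_distrib]
    exact Finset.sum_congr rfl fun i _ ↦ by simp only [e]; ring
  have hmc : Measurable fun b : ι → ℝ ↦ ∑ i, c i * b i := by fun_prop
  have hme : Measurable fun b : ι → ℝ ↦ ∑ i, e i * b i := by fun_prop
  have hmap : (Measure.pi fun _ : ι ↦ gaussianReal 0 1).map
      (fun b ↦ (∑ i, c i * b i, ∑ i, e i * b i)) =
      (gaussianReal 0 A.toNNReal).prod (gaussianReal 0 (C - B ^ 2 / A).toNNReal) := by
    have hind := (hasGaussianLaw_pi_linear c e).indepFun_of_covariance_eq_zero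
      (by rw [covariance_pi_linear, hce])
    rw [(indepFun_iff_map_prod_eq_prod_map_map hmc.aemeasurable hme.aemeasurable).1 hind,
      map_pi_linear, map_pi_linear, hA, hE]
  have hAnn : A.toNNReal ≠ 0 := by simpa using hApos
  have hφ : Measurable (gaussianPDF 0 1) := measurable_gaussianPDF 0 1
  have hpair : ∫⁻ b : ι → ℝ, gaussianPDF 0 1 (∑ i, c i * b i) *
        ENNReal.ofReal |∑ i, e i * b i + B / A * ∑ i, c i * b i|
        ∂(Measure.pi fun _ ↦ gaussianReal 0 1) =
      ∫⁻ p, gaussianPDF 0 1 p.1 * ENNReal.ofReal |p.2 + B / A * p.1|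
        ∂((gaussianReal 0 A.toNNReal).prod (gaussianReal 0 (C - B ^ 2 / A).toNNReal)) := by
    rw [← hmap, lintegral_map (by fun_prop) (by fun_prop)]
  simp_rw [hd]
  rw [hpair, lintegral_prod _ (by fun_prop)]
  have hm2 : Measurable fun x : ℝ ↦ ∫⁻ y, ENNReal.ofReal |y + B / A * x|
      ∂(gaussianReal 0 (C - B ^ 2 / A).toNNReal) :=
    Measurable.lintegral_prod_right' (f := fun p : ℝ × ℝ ↦ ENNReal.ofReal |p.2 + B / A * p.1|)
      (by fun_prop)
  have hin : ∀ x : ℝ, ∫⁻ y, gaussianPDF 0 1 x * ENNReal.ofReal |y + B / A * x|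
      ∂(gaussianReal 0 (C - B ^ 2 / A).toNNReal) =
      (gaussianPDF 0 1 * fun x ↦ ∫⁻ y, ENNReal.ofReal |y + B / A * x|
      ∂(gaussianReal 0 (C - B ^ 2 / A).toNNReal)) x := by
    intro x
    rw [lintegral_const_mul _ (by fun_prop)]
    rfl
  simp_rw [hin]
  rw [← lintegral_withDensity_eq_lintegral_mul _ hφ hm2, gaussianReal_withDensity_gaussianPDF _ hAnn,
    lintegral_smul_measure]
  have hconv : ∫⁻ x, ∫⁻ y, ENNReal.ofReal |y + B / A * x|
      ∂(gaussianReal 0 (C - B ^ 2 / A).toNNReal) ∂(gaussianReal 0 (A.toNNReal / (1 + A.toNNReal)))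
      = ENNReal.ofReal (√(2 * (C - B ^ 2 / (1 + A)) / π)) := by
    have h1 : ∫⁻ x, ∫⁻ y, ENNReal.ofReal |y + B / A * x|
      ∂(gaussianReal 0 (C - B ^ 2 / A).toNNReal) ∂(gaussianReal 0 (A.toNNReal / (1 + A.toNNReal)))
      = ∫⁻ x, ∫⁻ y, ENNReal.ofReal |x + y| ∂(gaussianReal 0 (C - B ^ 2 / A).toNNReal)
        ∂((gaussianReal 0 (A.toNNReal / (1 + A.toNNReal))).map (fun x ↦ B / A * x)) := by
      rw [lintegral_map _ (by fun_prop)]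
      · simp_rw [add_comm]
      · exact Measurable.lintegral_prod_right' (f := fun p : ℝ × ℝ ↦ ENNReal.ofReal |p.1 + p.2|)
          (by fun_prop)
    rw [h1, ← Measure.lintegral_conv (f := fun z ↦ ENNReal.ofReal |z|) (by fun_prop),
      gaussianReal_map_const_mul, gaussianReal_conv_gaussianReal, mul_zero, add_zero,
      lintegral_abs_gaussianReal]
    congr 3
    simp only [NNReal.coe_add, NNReal.coe_mul, NNReal.coe_mk, NNReal.coe_div, NNReal.coe_one,
      Real.coe_toNNReal _ hApos.le, Real.coe_toNNReal _ hEnn]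
    field_simp
    ring
  rw [hconv, smul_eq_mul, ← ENNReal.ofReal_mul (by positivity), ← ENNReal.ofReal_div_of_pos pi_pos,
    Real.coe_toNNReal _ hApos.le]
  congr 1
  rw [← sqrt_inv, ← sqrt_mul (by positivity)]
  have hπ : (2 * π * (1 + A))⁻¹ * (2 * (C - B ^ 2 / (1 + A)) / π) =
      (C / (1 + A) - B ^ 2 / (1 + A) ^ 2) / π ^ 2 := by
    field_simp
  rw [hπ, sqrt_div' _ (sq_nonneg π), sqrt_sq pi_pos.le]

theorem sum_nat_mul_pow_mul (s : ℝ) (n : ℕ) :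
    (∑ i ∈ Finset.range (n + 1), (i : ℝ) * s ^ i) * (s - 1) ^ 2 =
      n * s ^ (n + 2) - (n + 1) * s ^ (n + 1) + s := by
  induction n with
  | zero => simp
  | succ n ih => rw [Finset.sum_range_succ, add_mul, ih]; push_cast; ring

theorem sum_nat_sq_mul_pow_mul (s : ℝ) (n : ℕ) :
    (∑ i ∈ Finset.range (n + 1), (i : ℝ) ^ 2 * s ^ i) * (s - 1) ^ 3 =
      n ^ 2 * s ^ (n + 3) - (2 * n ^ 2 + 2 * n - 1) * s ^ (n + 2) + (n + 1) ^ 2 * s ^ (n + 1)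
        - s ^ 2 - s := by
  induction n with
  | zero => simp
  | succ n ih => rw [Finset.sum_range_succ, add_mul, ih]; push_cast; ring

theorem kac_density_eq {n : ℕ} {s K L M : ℝ} (h0 : s ≠ 0) (h1 : s ≠ 1) (hK0 : K ≠ 0)
    (hK : K * (s - 1) = s ^ (n + 1) - 1)
    (hL : L * (s - 1) ^ 2 = n * s ^ (n + 2) - (n + 1) * s ^ (n + 1) + s)
    (hM : M * (s - 1) ^ 3 = n ^ 2 * s ^ (n + 3) - (2 * n ^ 2 + 2 * n - 1) * s ^ (n + 2)
        + (n + 1) ^ 2 * s ^ (n + 1) - s ^ 2 - s) :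
    M / s / K - L ^ 2 / s / K ^ 2 =
      1 / (s - 1) ^ 2 - ((n + 1) ^ 2 * s ^ n) / (s ^ (n + 1) - 1) ^ 2 := by
  have hs : s - 1 ≠ 0 := sub_ne_zero.2 h1
  rw [← hK]
  have hKe : K = (s ^ (n + 1) - 1) / (s - 1) := by field_simp; linarith
  have hLe : L = (n * s ^ (n + 2) - (n + 1) * s ^ (n + 1) + s) / (s - 1) ^ 2 := by
    field_simp; linarith
  have hMe : M = (n ^ 2 * s ^ (n + 3) - (2 * n ^ 2 + 2 * n - 1) * s ^ (n + 2)
        + (n + 1) ^ 2 * s ^ (n + 1) - s ^ 2 - s) / (s - 1) ^ 3 := by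
    field_simp; linarith
  have key : M * K * (s - 1) ^ 2 - L ^ 2 * (s - 1) ^ 2 = s * K ^ 2 - s * (n + 1) ^ 2 * s ^ n := by
    rw [hKe, hLe, hMe]
    field_simp
    ring
  field_simp
  linear_combination key

theorem measurable_encard_zeros (n : ℕ) :
    Measurable fun a : Fin (n + 1) → ℝ ↦
      ({t : ℝ | ∑ i : Fin (n + 1), a i * t ^ (i : ℕ) = 0}.encard : ℝ≥0∞) :=
  measurable_encard_fiber (F := fun (a : Fin (n + 1) → ℝ) t ↦ ∑ i, a i * t ^ (i : ℕ))
    (by unfold Function.uncurry; fun_prop)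

theorem lintegral_encard_zeros_cons {n : ℕ} (b : Fin n → ℝ) :
    ∫⁻ y, ({t : ℝ | ∑ i : Fin (n + 1), (Fin.cons y b : Fin (n + 1) → ℝ) i * t ^ (i : ℕ) =
        0}.encard : ℝ≥0∞) ∂(gaussianReal 0 1) =
      ∫⁻ t, gaussianPDF 0 1 (∑ i : Fin n, t ^ ((i : ℕ) + 1) * b i) *
        ENNReal.ofReal |∑ i : Fin n, ((i : ℕ) + 1 : ℝ) * t ^ (i : ℕ) * b i| := by
  have hset : ∀ y : ℝ, {t : ℝ | ∑ i : Fin (n + 1),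
      (Fin.cons y b : Fin (n + 1) → ℝ) i * t ^ (i : ℕ) = 0} =
      {t | -∑ i : Fin n, t ^ ((i : ℕ) + 1) * b i = y} := by
    intro y
    ext t
    simp only [mem_ofPred_eq, Fin.sum_univ_succ, Fin.cons_zero, Fin.cons_succ, Fin.val_zero,
      Fin.val_succ, pow_zero, mul_one, mul_comm (b _)]
    constructor <;> intro h <;> linarith
  have hf : ∀ t : ℝ, HasDerivAt (fun t ↦ -∑ i : Fin n, t ^ ((i : ℕ) + 1) * b i)
      (-∑ i : Fin n, ((i : ℕ) + 1 : ℝ) * t ^ (i : ℕ) * b i) t := by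
    intro t
    refine (HasDerivAt.fun_sum fun i _ ↦ HasDerivAt.mul_const ?_ _).neg
    simpa using hasDerivAt_pow ((i : ℕ) + 1) t
  have hm : Measurable fun y : ℝ ↦
      ({t | -∑ i : Fin n, t ^ ((i : ℕ) + 1) * b i = y}.encard : ℝ≥0∞) := by
    simp_rw [← hset]
    exact (measurable_encard_zeros n).comp
      (measurable_pi_iff.2 (Fin.cases (by simpa using measurable_id') (by simp)))
  simp_rw [hset]
  rw [gaussianReal_of_var_ne_zero _ one_ne_zero,
    lintegral_withDensity_eq_lintegral_mul _ (measurable_gaussianPDF 0 1) hm]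
  simp only [Pi.mul_apply]
  rw [lintegral_mul_encard_fiber hf (by fun_prop) (measurable_gaussianPDF 0 1)]
  refine lintegral_congr fun t ↦ ?_
  rw [abs_neg, mul_comm]
  congr 1
  simp [gaussianPDF, gaussianPDFReal]

theorem lintegral_gaussianPDF_mul_abs_eval {n : ℕ} (hn : 1 ≤ n) {t : ℝ} (ht0 : t ≠ 0)
    (ht1 : t ≠ 1) (ht2 : t ≠ -1) :
    ∫⁻ b : Fin n → ℝ, gaussianPDF 0 1 (∑ i : Fin n, t ^ ((i : ℕ) + 1) * b i) *
        ENNReal.ofReal |∑ i : Fin n, ((i : ℕ) + 1 : ℝ) * t ^ (i : ℕ) * b i|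
        ∂(Measure.pi fun _ ↦ gaussianReal 0 1) =
      ENNReal.ofReal (√(1 / (t ^ 2 - 1) ^ 2
          - ((n + 1 : ℝ) ^ 2 * t ^ (2 * n)) / (t ^ (2 * n + 2) - 1) ^ 2)) *
        (ENNReal.ofReal π)⁻¹ := by
  have hs0 : t ^ 2 ≠ 0 := pow_ne_zero 2 ht0
  have hs1 : t ^ 2 ≠ 1 := by
    rw [Ne, sq_eq_one_iff]
    exact not_or.2 ⟨ht1, ht2⟩
  have hK : 1 + ∑ i : Fin n, (t ^ ((i : ℕ) + 1)) ^ 2 =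
      ∑ i ∈ Finset.range (n + 1), (t ^ 2) ^ i := by
    rw [Finset.sum_range_succ', Finset.sum_range, pow_zero, add_comm]
    simp_rw [← pow_mul, mul_comm]
  have hL : ∑ i : Fin n, t ^ ((i : ℕ) + 1) * (((i : ℕ) + 1 : ℝ) * t ^ (i : ℕ)) =
      (∑ i ∈ Finset.range (n + 1), (i : ℝ) * (t ^ 2) ^ i) / t := by
    rw [Finset.sum_range_succ', Finset.sum_range, eq_div_iff ht0, Finset.sum_mul]
    simp only [Nat.cast_zero, zero_mul, add_zero, Nat.cast_add, Nat.cast_one]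
    exact Finset.sum_congr rfl fun i _ ↦ by ring
  have hM : ∑ i : Fin n, (((i : ℕ) + 1 : ℝ) * t ^ (i : ℕ)) ^ 2 =
      (∑ i ∈ Finset.range (n + 1), (i : ℝ) ^ 2 * (t ^ 2) ^ i) / t ^ 2 := by
    rw [Finset.sum_range_succ', Finset.sum_range, eq_div_iff hs0, Finset.sum_mul]
    simp only [Nat.cast_zero, ne_eq, OfNat.ofNat_ne_zero, not_false_eq_true, zero_pow, zero_mul,
      add_zero, Nat.cast_add, Nat.cast_one]
    exact Finset.sum_congr rfl fun i _ ↦ by ring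
  have hA0 : 0 < ∑ i : Fin n, (t ^ ((i : ℕ) + 1)) ^ 2 := by
    have : Nonempty (Fin n) := ⟨⟨0, hn⟩⟩
    exact Finset.sum_pos (fun i _ ↦ by positivity) Finset.univ_nonempty
  have hK0 : ∑ i ∈ Finset.range (n + 1), (t ^ 2) ^ i ≠ 0 := by
    rw [← hK]; positivity
  rw [lintegral_gaussianPDF_mul_abs_pi (fun i : Fin n ↦ t ^ ((i : ℕ) + 1))
    (fun i : Fin n ↦ ((i : ℕ) + 1 : ℝ) * t ^ (i : ℕ)) rfl hL hM hA0.ne', hK, div_pow,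
    kac_density_eq hs0 hs1 hK0 (geom_sum_mul _ _) (sum_nat_mul_pow_mul _ n)
      (sum_nat_sq_mul_pow_mul _ n), div_eq_mul_inv (ENNReal.ofReal _), ← pow_mul, ← pow_mul,
    mul_add, mul_one]

theorem kac_formula (n : ℕ) (hn : 1 ≤ n) :
    ∫⁻ a : Fin (n + 1) → ℝ,
        ({t : ℝ | ∑ i : Fin (n + 1), a i * t ^ (i : ℕ) = 0}.encard : ℝ≥0∞)
        ∂(Measure.pi fun _ => gaussianReal 0 1)
      = (∫⁻ t : ℝ, ENNReal.ofReal
          (Real.sqrt (1 / (t ^ 2 - 1) ^ 2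
            - ((n + 1 : ℝ) ^ 2 * t ^ (2 * n)) / (t ^ (2 * n + 2) - 1) ^ 2)))
        / ENNReal.ofReal π := by
  have hsplit := (measurePreserving_piFinSuccAbove
    (fun _ : Fin (n + 1) ↦ gaussianReal 0 1) 0).symm.lintegral_comp (measurable_encard_zeros n)
  rw [← hsplit, lintegral_prod_symm' _
    (by exact (measurable_encard_zeros n).comp (MeasurableEquiv.measurable _))]
  have hcons : ∀ (y : ℝ) (b : Fin n → ℝ),
      (MeasurableEquiv.piFinSuccAbove (fun _ : Fin (n + 1) ↦ ℝ) 0).symm (y, b) = Fin.cons y b := by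
    intro y b
    simp [MeasurableEquiv.piFinSuccAbove, Fin.insertNthEquiv]
  simp_rw [hcons, lintegral_encard_zeros_cons]
  rw [lintegral_lintegral_swap, div_eq_mul_inv, ← lintegral_mul_const' _ _ (by simp [pi_pos])]
  · refine lintegral_congr_ae ?_
    filter_upwards [compl_mem_ae_iff.2 (measure_singleton (0 : ℝ)),
      compl_mem_ae_iff.2 (measure_singleton (1 : ℝ)),
      compl_mem_ae_iff.2 (measure_singleton (-1 : ℝ))] with t h0 h1 h2
    exact lintegral_gaussianPDF_mul_abs_eval hn h0 h1 h2
  · have hφ := measurable_gaussianPDF 0 1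
    unfold Function.uncurry
    fun_prop
end

section
/- Define Eₙ = (1/π) ∫_ℝ √( 1/(t²−1)² − (n+1)²·t^(2n)/(t^(2n+2)−1)² ) dt (the Kac integral, equal to the expected number of real zeros of a degree-n random polynomial with independent standard normal coefficients). Then, as n → ∞, Eₙ = (2/π)·log n + C₁ + 2/(nπ) + O(1/n²), where C₁ = (2/π)·( log 2 + ∫₀^∞ { √( 1/x² − 4e^(−2x)/(1−e^(−2x))² ) − 1/(x+1) } dx ). (Theorem 2.2.) -/
open MeasureTheory Real Set
open scoped ENNReal NNReal
open Filter Topology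

theorem add_pow_le_sinh {x : ℝ} (hx : 0 ≤ x) : x + x ^ 3 / 6 + x ^ 5 / 120 ≤ sinh x := by
  have h := sum_le_hasSum (Finset.range 3) (fun i _ => by positivity) (Real.hasSum_sinh x)
  simp only [Finset.sum_range_succ, Finset.sum_range_zero] at h
  norm_num [Nat.factorial] at h
  exact h

theorem sinh_le_mul_cosh {x : ℝ} (hx : 0 ≤ x) : sinh x ≤ x * cosh x := by
  refine hasSum_le (fun n => ?_) (Real.hasSum_sinh x) ((Real.hasSum_cosh x).mul_left x)
  rw [← mul_div_assoc, ← pow_succ']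
  gcongr
  omega

theorem inv_sub_inv_sinh_le {x : ℝ} (hx : 0 < x) : 1 / x - 1 / sinh x ≤ x / 2 := by
  have hs : 0 < sinh x := sinh_pos_iff.2 hx
  have key : sinh x * (1 - x ^ 2 / 2) ≤ x := by
    rcases le_total (1 - x ^ 2 / 2) 0 with h | h
    · nlinarith
    · have h1 : cosh x * (1 - x ^ 2 / 2) ≤ exp (x ^ 2 / 2) * exp (-(x ^ 2 / 2)) := by
        gcongr
        · exact cosh_le_exp_half_sq x
        · linarith [add_one_le_exp (-(x ^ 2 / 2))]
      rw [← exp_add, add_neg_cancel, exp_zero] at h1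
      have h2 := mul_le_mul_of_nonneg_right (sinh_le_mul_cosh hx.le) h
      nlinarith
  rw [div_sub_div _ _ hx.ne' hs.ne', div_le_iff₀ (by positivity)]
  nlinarith

theorem sq_div_two_le_sinh {x : ℝ} (hx : 0 ≤ x) : x ^ 2 / 2 ≤ sinh x := by
  have h := add_pow_le_sinh hx
  have : 0 ≤ x ^ 5 := by positivity
  nlinarith [mul_nonneg hx (sq_nonneg (x - 3 / 2))]

theorem natCast_mul_sinh_le (k : ℕ) {y : ℝ} (hy : 0 ≤ y) : k * sinh y ≤ sinh (k * y) := by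
  induction k with
  | zero => simp
  | succ k ih =>
    push_cast
    rw [add_mul, add_mul, one_mul, one_mul, sinh_add]
    have h1 := one_le_cosh y
    have h2 := one_le_cosh (k * y)
    have h3 : 0 ≤ sinh y := sinh_nonneg_iff.2 hy
    have h4 : 0 ≤ sinh (k * y) := sinh_nonneg_iff.2 (by positivity)
    nlinarith

theorem abs_sqrt_sub_sqrt_sub_le {a b c : ℝ} (hb : 0 < b) (hba : b ≤ a) (hac : a ≤ c)
    (hbc : b < c) :
    |√(a ^ 2 - b ^ 2) - √(c ^ 2 - b ^ 2) - (a - c)| ≤ (c - a) * (2 * (b / √(c ^ 2 - b ^ 2))) := by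
  have hq : 0 < √(c ^ 2 - b ^ 2) := Real.sqrt_pos.2 (by nlinarith)
  have hq2 : √(c ^ 2 - b ^ 2) ^ 2 = c ^ 2 - b ^ 2 := Real.sq_sqrt (by nlinarith)
  have hp : 0 ≤ √(a ^ 2 - b ^ 2) := Real.sqrt_nonneg _
  have hp2 : √(a ^ 2 - b ^ 2) ^ 2 = a ^ 2 - b ^ 2 := Real.sq_sqrt (by nlinarith)
  set p := √(a ^ 2 - b ^ 2)
  set q := √(c ^ 2 - b ^ 2)
  have hpa : p ≤ a := by nlinarith
  have hqc : q ≤ c := by nlinarith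
  have hap : a ≤ b + p := by nlinarith
  have hcq : c ≤ b + q := by nlinarith
  have e : p - q - (a - c) = -((c - a) * ((a - p + (c - q)) / (p + q))) := by
    field_simp
    nlinarith
  rw [e, abs_neg, abs_of_nonneg (by
    have : 0 ≤ a - p + (c - q) := by linarith
    have : 0 ≤ c - a := by linarith
    positivity)]
  have h1 : (a - p + (c - q)) / (p + q) ≤ 2 * (b / q) := by
    rw [← mul_div_assoc]
    exact div_le_div₀ (by positivity) (by linarith) hq (by linarith)
  exact mul_le_mul_of_nonneg_left h1 (by linarith)

theorem inv_sinh_div_sqrt_le {x : ℝ} (hx : 0 < x) :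
    (1 / sinh x) / √((1 / x) ^ 2 - (1 / sinh x) ^ 2) ≤ 32 / (x * (1 + x ^ 2)) := by
  have hs : 0 < sinh x := sinh_pos_iff.2 hx
  have hxs : x < sinh x := self_lt_sinh_iff.2 hx
  have h : x ^ 4 * (1 + x ^ 2) ^ 2 ≤ 1024 * (sinh x ^ 2 - x ^ 2) := by
    have h1 := pow_le_pow_left₀ (by positivity) (add_pow_le_sinh hx.le) 2
    have : 0 ≤ x ^ 4 := by positivity
    have : 0 ≤ x ^ 6 := by positivity
    have : 0 ≤ x ^ 8 := by positivity
    have : 0 ≤ x ^ 10 := by positivity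
    nlinarith
  have hpos : 0 < (1 / x) ^ 2 - (1 / sinh x) ^ 2 := by
    have := one_div_lt_one_div_of_lt hx hxs
    have : 0 < 1 / sinh x := by positivity
    nlinarith
  rw [div_le_div_iff₀ (Real.sqrt_pos.2 hpos) (by positivity),
    ← div_le_iff₀' (by norm_num)]
  apply Real.le_sqrt_of_sq_le
  field_simp
  nlinarith

theorem integrableOn_of_abs_le_of_sq_mul_abs_le {f : ℝ → ℝ} (hf : Measurable f) (A B : ℝ)
    (hA : ∀ x, 0 < x → |f x| ≤ A) (hB : ∀ x, 0 < x → x ^ 2 * |f x| ≤ B) :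
    IntegrableOn f (Ioi 0) := by
  refine Integrable.mono' (g := fun x : ℝ => (A + B) * (1 + x ^ 2)⁻¹)
    ((integrable_inv_one_add_sq.integrableOn).const_mul _) hf.aestronglyMeasurable ?_
  refine (ae_restrict_iff' measurableSet_Ioi).2 (ae_of_all _ fun x hx => ?_)
  rw [norm_eq_abs, ← div_eq_mul_inv, le_div_iff₀ (by positivity)]
  nlinarith [hA x hx, hB x hx]

theorem kac_scaled_bounds {N : ℕ} (hN : 0 < N) {x : ℝ} (hx : 0 < x) :
    0 < 1 / sinh x ∧ 1 / sinh x ≤ 1 / (N * sinh (x / N)) ∧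
    1 / (N * sinh (x / N)) ≤ 1 / x ∧ 1 / sinh x < 1 / x ∧
    1 / x - 1 / (N * sinh (x / N)) ≤ x / (2 * N ^ 2) ∧
    x ^ 2 * (1 / (N * sinh (x / N))) ≤ 2 * N := by
  have hN' : (0 : ℝ) < N := by exact_mod_cast hN
  have hy : 0 < x / N := by positivity
  have hs : 0 < sinh x := sinh_pos_iff.2 hx
  have hsy : 0 < sinh (x / N) := sinh_pos_iff.2 hy
  refine ⟨by positivity, ?_, ?_, ?_, ?_, ?_⟩
  · apply one_div_le_one_div_of_le (by positivity)
    have := natCast_mul_sinh_le N hy.le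
    rwa [mul_div_cancel₀ _ hN'.ne'] at this
  · apply one_div_le_one_div_of_le hx
    have := self_le_sinh_iff.2 hy.le
    rwa [div_le_iff₀' hN'] at this
  · exact one_div_lt_one_div_of_lt hx (self_lt_sinh_iff.2 hx)
  · have := inv_sub_inv_sinh_le hy
    calc 1 / x - 1 / (N * sinh (x / N)) = (1 / (x / N) - 1 / sinh (x / N)) / N := by
          field_simp
      _ ≤ (x / N / 2) / N := by gcongr
      _ = x / (2 * N ^ 2) := by field_simp
  · have := sq_div_two_le_sinh hy.le
    rw [mul_one_div, div_le_iff₀ (by positivity)]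
    field_simp at this
    nlinarith

theorem integrableOn_sqrt_scaled {N : ℕ} (hN : 0 < N) :
    IntegrableOn (fun x : ℝ => √((1 / (N * sinh (x / N))) ^ 2 - (1 / sinh x) ^ 2)) (Ioi 0) := by
  have hle : ∀ x : ℝ, 0 < x → √((1 / (N * sinh (x / N))) ^ 2 - (1 / sinh x) ^ 2)
      ≤ 1 / (N * sinh (x / N)) := fun x hx => by
    obtain ⟨h1, h2, h3, h4, h5, h6⟩ := kac_scaled_bounds hN hx
    exact Real.sqrt_le_iff.2 ⟨by linarith, by nlinarith⟩
  refine integrableOn_of_abs_le_of_sq_mul_abs_le (by fun_prop) 1 (2 * N) (fun x hx => ?_)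
    (fun x hx => ?_)
  · rw [abs_of_nonneg (Real.sqrt_nonneg _)]
    obtain ⟨h1, h2, h3, h4, h5, h6⟩ := kac_scaled_bounds hN hx
    have h := inv_sub_inv_sinh_le hx
    have hxx : x * (1 / x) = 1 := by field_simp
    refine Real.sqrt_le_iff.2 ⟨by norm_num, ?_⟩
    nlinarith
  · rw [abs_of_nonneg (Real.sqrt_nonneg _)]
    obtain ⟨h1, h2, h3, h4, h5, h6⟩ := kac_scaled_bounds hN hx
    exact (mul_le_mul_of_nonneg_left (hle x hx) (sq_nonneg x)).trans h6

theorem integrableOn_sqrt_sub :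
    IntegrableOn (fun x : ℝ => √((1 / x) ^ 2 - (1 / sinh x) ^ 2) - 1 / (x + 1)) (Ioi 0) := by
  refine integrableOn_of_abs_le_of_sq_mul_abs_le (by fun_prop) 1 3 (fun x hx => ?_)
    (fun x hx => ?_)
  · obtain ⟨h1, h2, h3, h4, h5, h6⟩ := kac_scaled_bounds one_pos hx
    have h := inv_sub_inv_sinh_le hx
    have hxx : x * (1 / x) = 1 := by field_simp
    have e1 : √((1 / x) ^ 2 - (1 / sinh x) ^ 2) ≤ 1 :=
      Real.sqrt_le_iff.2 ⟨by norm_num, by nlinarith⟩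
    have e2 := Real.sqrt_nonneg ((1 / x) ^ 2 - (1 / sinh x) ^ 2)
    have e3 : 0 ≤ 1 / (x + 1) := by positivity
    have e4 : 1 / (x + 1) ≤ 1 := by rw [div_le_one (by positivity)]; linarith
    rw [abs_le]; constructor <;> linarith
  · obtain ⟨h1, h2, h3, h4, h5, h6⟩ := kac_scaled_bounds one_pos hx
    have hp2 : √((1 / x) ^ 2 - (1 / sinh x) ^ 2) ^ 2 = (1 / x) ^ 2 - (1 / sinh x) ^ 2 :=
      Real.sq_sqrt (by nlinarith)
    have hp := Real.sqrt_nonneg ((1 / x) ^ 2 - (1 / sinh x) ^ 2)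
    set p := √((1 / x) ^ 2 - (1 / sinh x) ^ 2)
    have hpc : p ≤ 1 / x := by nlinarith
    have hxx : x * (1 / x) = 1 := by field_simp
    have hb2 : x ^ 2 * (1 / sinh x) ≤ 2 := by simpa using h6
    have hcp : 1 / x - p ≤ x * (1 / sinh x) ^ 2 := by
      have h : 1 / x * (1 / x - p) ≤ (1 / sinh x) ^ 2 := by nlinarith
      calc 1 / x - p = x * (1 / x * (1 / x - p)) := by field_simp
        _ ≤ _ := by gcongr
    have hxb : x * (1 / sinh x) ≤ 1 := by nlinarith
    have e1 : x ^ 2 * (1 / x - p) ≤ 2 := by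
      calc x ^ 2 * (1 / x - p) ≤ x ^ 2 * (x * (1 / sinh x) ^ 2) := by gcongr
        _ = (x * (1 / sinh x)) * (x ^ 2 * (1 / sinh x)) := by ring
        _ ≤ 1 * 2 := by gcongr
        _ = 2 := by norm_num
    have e2 : x ^ 2 * (1 / x - 1 / (x + 1)) ≤ 1 := by
      have : x ^ 2 * (1 / x - 1 / (x + 1)) = x / (x + 1) := by field_simp; ring
      rw [this, div_le_one (by positivity)]; linarith
    have e3 : 0 ≤ 1 / x - 1 / (x + 1) :=
      sub_nonneg.2 (one_div_le_one_div_of_le hx (by linarith))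
    have e4 : |p - 1 / (x + 1)| ≤ (1 / x - p) + (1 / x - 1 / (x + 1)) := by
      rw [abs_le]; constructor <;> linarith
    nlinarith [mul_le_mul_of_nonneg_left e4 (sq_nonneg x)]

theorem integrableOn_inv_sinh_sub {N : ℕ} (hN : 0 < N) :
    IntegrableOn (fun x : ℝ => 1 / (N * sinh (x / N)) - 1 / x + 1 / (x + 1)) (Ioi 0) := by
  have hN1 : (1 : ℝ) ≤ N := by exact_mod_cast hN
  refine integrableOn_of_abs_le_of_sq_mul_abs_le (by fun_prop) 1 (2 * N + 1) (fun x hx => ?_)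
    (fun x hx => ?_)
  · obtain ⟨h1, h2, h3, h4, h5, h6⟩ := kac_scaled_bounds hN hx
    have e3 : 0 ≤ 1 / (x + 1) := by positivity
    have e4 : 1 / (x + 1) ≤ 1 := by rw [div_le_one (by positivity)]; linarith
    have e5 : 1 / x - 1 / (N * sinh (x / N)) ≤ 1 := by
      rcases le_total x 1 with h | h
      · refine h5.trans ?_
        rw [div_le_one (by positivity)]
        nlinarith
      · have : 1 / x ≤ 1 := by rw [div_le_one hx]; exact h
        linarith
    rw [abs_le]; constructor <;> linarith
  · obtain ⟨h1, h2, h3, h4, h5, h6⟩ := kac_scaled_bounds hN hx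
    have e2 : x ^ 2 * (1 / x - 1 / (x + 1)) ≤ 1 := by
      have : x ^ 2 * (1 / x - 1 / (x + 1)) = x / (x + 1) := by field_simp; ring
      rw [this, div_le_one (by positivity)]; linarith
    have e3 : 0 ≤ 1 / x - 1 / (x + 1) :=
      sub_nonneg.2 (one_div_le_one_div_of_le hx (by linarith))
    have e4 : |1 / (N * sinh (x / N)) - 1 / x + 1 / (x + 1)|
        ≤ 1 / (N * sinh (x / N)) + (1 / x - 1 / (x + 1)) := by
      rw [abs_le]; constructor <;> linarith
    nlinarith [mul_le_mul_of_nonneg_left e4 (sq_nonneg x)]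

theorem integral_inv_sinh_sub {N : ℕ} (hN : 0 < N) :
    ∫ x in Ioi (0 : ℝ), (1 / (N * sinh (x / N)) - 1 / x + 1 / (x + 1)) = log (2 * N) := by
  have hN' : (0 : ℝ) < N := by exact_mod_cast hN
  set G : ℝ → ℝ := fun x =>
    log (((1 - exp (-(x / N))) / x) * ((x + 1) / (1 + exp (-(x / N))))) with hG
  have hE : ∀ x : ℝ, HasDerivAt (fun x : ℝ => exp (-(x / N))) (exp (-(x / N)) * (-(1 / N))) x :=
    fun x => (((hasDerivAt_id x).div_const (N : ℝ)).neg).exp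
  have hlt : ∀ x : ℝ, 0 < x → exp (-(x / N)) < 1 := fun x hx => by
    rw [exp_lt_one_iff]
    have : 0 < x / N := by positivity
    linarith
  have hderiv : ∀ x ∈ Ioi (0 : ℝ), HasDerivAt (Function.update G 0 (-log (2 * N)))
      (1 / (N * sinh (x / N)) - 1 / x + 1 / (x + 1)) x := by
    intro x hx
    have hx : 0 < x := hx
    have h1 := hlt x hx
    have hep := exp_pos (-(x / N))
    have hd := ((((hE x).const_sub 1).div (hasDerivAt_id x) hx.ne').mul
      (((hasDerivAt_id x).add_const 1).div ((hE x).const_add 1) (by positivity))).log (by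
        have : 0 < 1 - exp (-(x / N)) := by linarith
        simp only [id, Pi.mul_apply, Pi.div_apply]
        positivity)
    refine (hd.congr_deriv ?_).congr_of_eventuallyEq ?_
    · have hs : sinh (x / N) = (1 - exp (-(x / N)) ^ 2) / (2 * exp (-(x / N))) := by
        rw [sinh_eq, exp_neg]
        have := exp_pos (x / N)
        field_simp
      rw [hs]
      simp only [id, Pi.mul_apply, Pi.div_apply]
      generalize exp (-(x / N)) = u at *
      have h2 : (1 - u) ≠ 0 := by linarith
      have h4 : (1 - u ^ 2) ≠ 0 := by
        have : (1 - u ^ 2) = (1 - u) * (1 + u) := by ring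
        rw [this]; positivity
      have h3 : (1 + u) ≠ 0 := by linarith
      field_simp
      ring
    · filter_upwards [eventually_ne_nhds hx.ne'] with z hz
      simp [Function.update_of_ne hz, hG]
  have hcont : ContinuousWithinAt (Function.update G 0 (-log (2 * N))) (Ici 0) 0 := by
    rw [continuousWithinAt_update_same]
    have hsl : Tendsto (fun x : ℝ => (1 - exp (-(x / N))) / x) (𝓝[≠] 0) (𝓝 (1 / N)) := by
      have h := ((hE 0).const_sub 1).tendsto_slope_zero
      simp at h
      rw [one_div]
      exact h.congr fun x => (div_eq_inv_mul _ _).symm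
    have h2 : Tendsto (fun x : ℝ => (x + 1) / (1 + exp (-(x / N)))) (𝓝[≠] 0) (𝓝 (1 / 2)) := by
      have : ContinuousAt (fun x : ℝ => (x + 1) / (1 + exp (-(x / N)))) 0 :=
        ContinuousAt.div (by fun_prop) (by fun_prop) (by positivity)
      have h := this.tendsto.mono_left (nhdsWithin_le_nhds (s := {0}ᶜ))
      convert h using 2
      norm_num
    have h3 := (hsl.mul h2).log (by positivity)
    have h4 : log (1 / (N : ℝ) * (1 / 2)) = -log (2 * N) := by
      rw [← log_inv]; congr 1; field_simp
    rw [h4] at h3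
    exact h3.mono_left (nhdsWithin_mono _ fun x hx => hx.2)
  have hlim : Tendsto (Function.update G 0 (-log (2 * N))) atTop (𝓝 0) := by
    have h0 : Tendsto (fun x : ℝ => exp (-(x / N))) atTop (𝓝 0) :=
      tendsto_exp_neg_atTop_nhds_zero.comp (tendsto_id.atTop_div_const hN')
    have h1 : Tendsto (fun x : ℝ => (1 - exp (-(x / N))) / (1 + exp (-(x / N))) * (1 + x⁻¹)) atTop
        (𝓝 ((1 - 0) / (1 + 0) * (1 + 0))) :=
      ((h0.const_sub 1).div (h0.const_add 1) (by norm_num)).mul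
        (tendsto_inv_atTop_zero.const_add 1)
    have h2 := h1.log (by norm_num)
    norm_num at h2
    refine h2.congr' ?_
    filter_upwards [eventually_gt_atTop 0] with x hx
    rw [Function.update_of_ne hx.ne', hG]
    simp only
    congr 1
    have := exp_pos (-(x / N))
    field_simp
  rw [integral_Ioi_of_hasDerivAt_of_tendsto hcont hderiv
    (integrableOn_inv_sinh_sub hN) hlim]
  simp

theorem integral_eq_two_mul_integral_exp (f : ℝ → ℝ) (hf : ∀ x, f (-x) = f x) :
    ∫ x, f x = 2 * ∫ s, exp s * f (exp s) := by
  have h1 : ∫ x, f x = 2 * ∫ x in Ioi (0 : ℝ), f x := by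
    rw [← integral_comp_abs]
    congr 1
    ext x
    rcases abs_choice x with h | h <;> rw [h]
    rw [hf]
  have h2 := integral_image_eq_integral_abs_deriv_smul (f := exp) (f' := exp) MeasurableSet.univ
    (fun x _ => (Real.hasDerivAt_exp x).hasDerivWithinAt) exp_injective.injOn f
  rw [image_univ, range_exp] at h2
  rw [h1, h2]
  simp [abs_of_pos (exp_pos _)]

theorem exp_mul_kac_integrand (n : ℕ) (s : ℝ) :
    exp s * √(1 / (exp s ^ 2 - 1) ^ 2
      - ((n + 1 : ℝ) ^ 2 * exp s ^ (2 * n)) / (exp s ^ (2 * n + 2) - 1) ^ 2)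
    = 1 / 2 * √((1 / sinh s) ^ 2 - ((n + 1 : ℝ) / sinh ((n + 1) * s)) ^ 2) := by
  rcases eq_or_ne s 0 with rfl | hs
  · simp
  have aux : ∀ t : ℝ, exp t ^ 2 - 1 = 2 * exp t * sinh t := fun t => by
    rw [sinh_eq, exp_neg]
    field_simp
  have e1 : exp s ^ (2 * n + 2) - 1 = 2 * (exp s ^ n * exp s) * sinh ((n + 1) * s) := by
    have := aux ((n + 1) * s)
    have h : exp ((n + 1) * s) = exp s ^ n * exp s := by
      rw [← pow_succ, ← exp_nat_mul]; push_cast; rfl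
    rw [h] at this
    rw [← this]; ring
  have hs1 : sinh s ≠ 0 := sinh_ne_zero.2 hs
  have hs2 : sinh ((n + 1) * s) ≠ 0 := sinh_ne_zero.2 (by positivity)
  rw [aux, e1]
  have : ∀ X : ℝ, 1 / 2 * √X = √((1 / 2) ^ 2 * X) := fun X => by
    rw [Real.sqrt_mul (by positivity), Real.sqrt_sq (by positivity)]
  rw [this]
  have : ∀ X : ℝ, exp s * √X = √((exp s) ^ 2 * X) := fun X => by
    rw [Real.sqrt_mul (by positivity), Real.sqrt_sq (by positivity)]
  rw [this]
  congr 1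
  have := exp_pos s
  field_simp
  ring

theorem kac_integral_eq (n : ℕ) :
    ∫ t : ℝ, √(1 / (t ^ 2 - 1) ^ 2
        - ((n + 1 : ℝ) ^ 2 * t ^ (2 * n)) / (t ^ (2 * n + 2) - 1) ^ 2)
    = 2 * ∫ x in Ioi (0 : ℝ),
        √((1 / ((n + 1 : ℕ) * sinh (x / (n + 1 : ℕ)))) ^ 2 - (1 / sinh x) ^ 2) := by
  rw [integral_eq_two_mul_integral_exp]
  swap
  · intro x
    rw [show 2 * n + 2 = 2 * (n + 1) by ring]
    simp only [pow_mul, neg_sq]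
  simp only [exp_mul_kac_integrand]
  rw [integral_const_mul]
  have h1 : ∫ s : ℝ, √((1 / sinh s) ^ 2 - ((n + 1 : ℝ) / sinh ((n + 1) * s)) ^ 2)
      = 2 * ∫ s in Ioi (0 : ℝ), √((1 / sinh s) ^ 2 - ((n + 1 : ℝ) / sinh ((n + 1) * s)) ^ 2) := by
    rw [← integral_comp_abs]
    congr 1
    ext x
    rcases abs_choice x with h | h <;> rw [h]
    simp [sinh_neg, div_neg]
  have hN : (0 : ℝ) < (n + 1 : ℕ) := by positivity
  have h2 := integral_comp_mul_left_Ioi (fun x : ℝ =>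
    √((1 / ((n + 1 : ℕ) * sinh (x / (n + 1 : ℕ)))) ^ 2 - (1 / sinh x) ^ 2)) 0 hN
  rw [mul_zero, smul_eq_mul, ← mul_left_cancel_iff_of_pos hN, mul_inv_cancel_left₀ hN.ne'] at h2
  rw [h1, ← h2, ← integral_const_mul]
  congr 1
  simp only [← integral_const_mul]
  congr 1
  ext s
  rw [mul_div_cancel_left₀ _ hN.ne']
  have : ∀ X : ℝ, ((n + 1 : ℕ) : ℝ) * √X = √(((n + 1 : ℕ) : ℝ) ^ 2 * X) := fun X => by
    rw [Real.sqrt_mul (by positivity), Real.sqrt_sq (by positivity)]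
  rw [this, ← mul_assoc]
  norm_num
  congr 1
  have : (n + 1 : ℝ) ≠ 0 := by positivity
  simp only [div_eq_mul_inv, mul_pow, mul_sub]
  field_simp

theorem abs_integral_sqrt_sub_le {N : ℕ} (hN : 0 < N) :
    |(∫ x in Ioi (0 : ℝ), √((1 / (N * sinh (x / N))) ^ 2 - (1 / sinh x) ^ 2))
      - (∫ x in Ioi (0 : ℝ), (√((1 / x) ^ 2 - (1 / sinh x) ^ 2) - 1 / (x + 1)))
      - log (2 * N)| ≤ 16 * π / (N : ℝ) ^ 2 := by
  rw [← integral_inv_sinh_sub hN,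
    ← integral_sub (integrableOn_sqrt_scaled hN) integrableOn_sqrt_sub,
    ← integral_sub (by exact (integrableOn_sqrt_scaled hN).sub integrableOn_sqrt_sub)
      (integrableOn_inv_sinh_sub hN), ← norm_eq_abs]
  have hbound : ∫ x in Ioi (0 : ℝ), 32 / (N : ℝ) ^ 2 * (1 + x ^ 2)⁻¹ = 16 * π / (N : ℝ) ^ 2 := by
    rw [integral_const_mul, integral_Ioi_inv_one_add_sq, arctan_zero]
    ring
  rw [← hbound]
  refine norm_integral_le_of_norm_le (integrable_inv_one_add_sq.integrableOn.const_mul _)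
    ((ae_restrict_iff' measurableSet_Ioi).2 (ae_of_all _ fun x hx => ?_))
  have hx : 0 < x := hx
  have hN' : (0 : ℝ) < N := by exact_mod_cast hN
  obtain ⟨h1, h2, h3, h4, h5, -⟩ := kac_scaled_bounds hN hx
  rw [norm_eq_abs]
  calc _ = |√((1 / (N * sinh (x / N))) ^ 2 - (1 / sinh x) ^ 2)
          - √((1 / x) ^ 2 - (1 / sinh x) ^ 2) - (1 / (N * sinh (x / N)) - 1 / x)| := by
        congr 1; ring
    _ ≤ (1 / x - 1 / (N * sinh (x / N)))
          * (2 * ((1 / sinh x) / √((1 / x) ^ 2 - (1 / sinh x) ^ 2))) :=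
        abs_sqrt_sub_sqrt_sub_le h1 h2 h3 h4
    _ ≤ (x / (2 * N ^ 2)) * (2 * (32 / (x * (1 + x ^ 2)))) := by
        have := inv_sinh_div_sqrt_le hx
        refine mul_le_mul h5 (by linarith) (by positivity) (by positivity)
    _ = 32 / (N : ℝ) ^ 2 * (1 + x ^ 2)⁻¹ := by field_simp

theorem four_mul_exp_div_eq (x : ℝ) :
    4 * exp (-2 * x) / (1 - exp (-2 * x)) ^ 2 = (1 / sinh x) ^ 2 := by
  rcases eq_or_ne x 0 with rfl | hx
  · simp
  have hs : sinh x ≠ 0 := sinh_ne_zero.2 hx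
  have e2 : exp (-2 * x) = exp (-x) ^ 2 := by rw [← exp_nat_mul]; congr 1; push_cast; ring
  have e1 : 1 - exp (-2 * x) = 2 * exp (-x) * sinh x := by
    rw [e2, sinh_eq, exp_neg]
    field_simp
  have := exp_pos (-x)
  rw [e1, e2]
  field_simp
  norm_num

theorem abs_log_succ_sub_le {n : ℕ} (hn : 0 < n) :
    |log (n + 1) - log n - 1 / n| ≤ 1 / (n : ℝ) ^ 2 := by
  have hn' : (0 : ℝ) < n := by exact_mod_cast hn
  have hpos : (0 : ℝ) < (n + 1) / n := by positivity
  rw [← log_div (by positivity) hn'.ne']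
  have h1 := log_le_sub_one_of_pos hpos
  have h2 := one_sub_inv_le_log_of_pos hpos
  have e1 : ((n : ℝ) + 1) / n - 1 = 1 / n := by field_simp; ring
  have e2 : 1 / (n : ℝ) - (1 - ((n + 1 : ℝ) / n)⁻¹) ≤ 1 / (n : ℝ) ^ 2 := by
    have : 1 / (n : ℝ) - (1 - ((n + 1 : ℝ) / n)⁻¹) = 1 / (n * (n + 1)) := by
      field_simp; ring
    rw [this]
    apply one_div_le_one_div_of_le (by positivity)
    nlinarith
  have e3 : 0 ≤ 1 / (n : ℝ) ^ 2 := by positivity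
  rw [abs_le]; constructor <;> linarith

/-- Theorem 2.2: the asymptotics of the Kac integral
`Eₙ = (1/π) ∫_ℝ √(1/(t²-1)² - (n+1)²·t^(2n)/(t^(2n+2)-1)²) dt`, namely
`Eₙ = (2/π) log n + C₁ + 2/(nπ) + O(1/n²)` where
`C₁ = (2/π)(log 2 + ∫₀^∞ (√(1/x² - 4e^(-2x)/(1-e^(-2x))²) - 1/(x+1)) dx)`. -/
theorem kac_asymptotics (E : ℕ → ℝ)
    (hE : ∀ n : ℕ, E n = (1 / π) *
      ∫ t : ℝ, Real.sqrt (1 / (t ^ 2 - 1) ^ 2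
        - ((n + 1 : ℝ) ^ 2 * t ^ (2 * n)) / (t ^ (2 * n + 2) - 1) ^ 2))
    (C₁ : ℝ)
    (hC₁ : C₁ = (2 / π) * (Real.log 2 +
      ∫ x in Set.Ioi (0 : ℝ),
        (Real.sqrt (1 / x ^ 2
            - 4 * Real.exp (-2 * x) / (1 - Real.exp (-2 * x)) ^ 2) - 1 / (x + 1)))) :
    ∃ (K : ℝ) (N : ℕ), ∀ n ≥ N,
      |E n - ((2 / π) * Real.log n + C₁ + 2 / (n * π))| ≤ K / (n : ℝ) ^ 2 := by
  refine ⟨33, 1, fun n hn => ?_⟩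
  have hn' : (0 : ℝ) < n := by exact_mod_cast hn
  have hmain := abs_integral_sqrt_sub_le n.succ_pos
  have hlog := abs_log_succ_sub_le hn
  simp only [four_mul_exp_div_eq, ← one_div_pow] at hC₁
  simp only [Nat.succ_eq_add_one] at hmain
  rw [hE, kac_integral_eq, hC₁]
  set J := ∫ x in Ioi (0 : ℝ),
    √((1 / ((n + 1 : ℕ) * sinh (x / (n + 1 : ℕ)))) ^ 2 - (1 / sinh x) ^ 2)
  set D := ∫ x in Ioi (0 : ℝ), (√((1 / x) ^ 2 - (1 / sinh x) ^ 2) - 1 / (x + 1))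
  rw [log_mul (by norm_num) (by positivity)] at hmain
  push_cast at hmain
  have hle : 16 * π / ((n : ℝ) + 1) ^ 2 ≤ 16 * π / (n : ℝ) ^ 2 := by
    gcongr
    linarith
  have hpi := pi_gt_three
  calc _ = |2 / π * ((J - D - (log 2 + log (n + 1))) + (log (n + 1) - log n - 1 / n))| := by
        congr 1
        field_simp
        ring
    _ ≤ 2 / π * (16 * π / (n : ℝ) ^ 2 + 1 / (n : ℝ) ^ 2) := by
        rw [abs_mul, abs_of_pos (by positivity : 0 < 2 / π)]
        gcongr
        exact (abs_add_le _ _).trans (add_le_add (hmain.trans hle) hlog)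
    _ = (32 + 2 / π) / (n : ℝ) ^ 2 := by
        field_simp
        ring
    _ ≤ 33 / (n : ℝ) ^ 2 := by
        gcongr
        have : 2 / π ≤ 1 := by rw [div_le_one pi_pos]; linarith
        linarith
end

section
/- Let n ≥ 1 and let a₀, a₁, …, aₙ be independent centered normal real random variables where aᵢ has variance equal to the binomial coefficient C(n,i). Then for every measurable set I ⊆ ℝ, the expected number of zeros in I of the random polynomial p(x) = a₀ + a₁x + ⋯ + aₙxⁿ equals ∫_I √n / (π(1+t²)) dt; in particular, the expected total number of real zeros of p equals √n. (Section 3.1.2.) -/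
open MeasureTheory ProbabilityTheory Real Set
open scoped ENNReal NNReal

/-- Change of variables on a set on which `(t, b) ↦ (g t b, b)` is injective. -/
theorem prod_image_eq_lintegral_abs_deriv {E : Type*} [MeasurableSpace E] {ν : Measure E}
    [SFinite ν] {g g' : ℝ → E → ℝ} {φ : ℝ → ℝ≥0∞} (hφ : Measurable φ)
    (hg : Measurable fun p : ℝ × E => g p.1 p.2) (hg' : Measurable fun p : ℝ × E => g' p.1 p.2)
    (hderiv : ∀ t b, HasDerivAt (fun s => g s b) (g' t b) t) {A : Set (ℝ × E)}
    (hA : MeasurableSet A) (hinj : InjOn (fun p : ℝ × E => (g p.1 p.2, p.2)) A)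
    (hm : MeasurableSet ((fun p : ℝ × E => (g p.1 p.2, p.2)) '' A)) :
    (((volume : Measure ℝ).withDensity φ).prod ν) ((fun p : ℝ × E => (g p.1 p.2, p.2)) '' A)
      = ∫⁻ p in A, ENNReal.ofReal |g' p.1 p.2| * φ (g p.1 p.2) ∂((volume : Measure ℝ).prod ν) := by
  have hslice (b : E) : (fun y => (y, b)) ⁻¹' ((fun p : ℝ × E => (g p.1 p.2, p.2)) '' A)
      = (fun t => g t b) '' ((fun t => (t, b)) ⁻¹' A) := by
    ext y
    constructor
    · rintro ⟨⟨t, c⟩, h, he⟩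
      obtain ⟨rfl, rfl⟩ := Prod.mk.inj he
      exact ⟨t, h, rfl⟩
    · rintro ⟨t, h, rfl⟩
      exact ⟨(t, b), h, rfl⟩
  have hmeas : Measurable fun p : ℝ × E => ENNReal.ofReal |g' p.1 p.2| * φ (g p.1 p.2) := by
    fun_prop
  rw [Measure.prod_apply_symm hm, ← lintegral_indicator hA,
    lintegral_prod_symm' _ (hmeas.indicator hA)]
  refine lintegral_congr fun b => ?_
  have hAb : MeasurableSet ((fun t : ℝ => (t, b)) ⁻¹' A) := measurable_prodMk_right hA
  have hms : MeasurableSet ((fun t => g t b) '' ((fun t => (t, b)) ⁻¹' A)) := by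
    rw [← hslice]; exact measurable_prodMk_right hm
  rw [hslice, withDensity_apply _ hms,
    lintegral_image_eq_lintegral_abs_deriv_mul hAb
      (fun t _ => (hderiv t b).hasDerivWithinAt) ?_, ← lintegral_indicator hAb]
  · rfl
  · intro s hs t ht hst
    exact (Prod.mk.inj (hinj hs ht (Prod.ext hst rfl))).1

/-- The regular points split into countably many pieces, on each of which every function of the
family is injective. -/
theorem exists_measurable_injOn_partition {E : Type*} [TopologicalSpace E]
    [SecondCountableTopology E] [MeasurableSpace E] [BorelSpace E] {g g' : ℝ → E → ℝ}
    (hg' : Continuous fun p : ℝ × E => g' p.1 p.2)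
    (hderiv : ∀ t b, HasDerivAt (fun s => g s b) (g' t b) t) :
    ∃ A : ℕ → Set (ℝ × E), (∀ k, MeasurableSet (A k)) ∧ Pairwise (Function.onFun Disjoint A) ∧
      (⋃ k, A k) = {p | g' p.1 p.2 ≠ 0} ∧
      ∀ k, InjOn (fun p : ℝ × E => (g p.1 p.2, p.2)) (A k) := by
  obtain ⟨r, hr⟩ := exists_surjective_nat (ℚ × ℚ)
  set B : ℕ → Set (ℝ × E) := fun k => Ioo ((r k).1 : ℝ) (r k).2 ×ˢ
    {b | ∀ s ∈ Icc ((r k).1 : ℝ) (r k).2, g' s b ≠ 0} with hB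
  have hopen (k : ℕ) : IsOpen {b | ∀ s ∈ Icc ((r k).1 : ℝ) (r k).2, g' s b ≠ 0} := by
    have hcl : IsClosed {p : Icc ((r k).1 : ℝ) (r k).2 × E | g' p.1 p.2 = 0} :=
      isClosed_eq (hg'.comp (by fun_prop : Continuous fun p : Icc ((r k).1 : ℝ) (r k).2 × E =>
        ((p.1 : ℝ), p.2))) continuous_const
    have := (isClosedMap_snd_of_compactSpace _ hcl).isOpen_compl
    convert this using 1
    ext b
    simp
  have hBm (k : ℕ) : MeasurableSet (B k) := measurableSet_Ioo.prod (hopen k).measurableSet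
  have hBinj (k : ℕ) : InjOn (fun p : ℝ × E => (g p.1 p.2, p.2)) (B k) := by
    have key {s t : ℝ} {b : E} (hs : s ∈ Ioo ((r k).1 : ℝ) (r k).2)
        (ht : t ∈ Ioo ((r k).1 : ℝ) (r k).2)
        (hb : ∀ s ∈ Icc ((r k).1 : ℝ) (r k).2, g' s b ≠ 0) (he : g s b = g t b) : ¬ s < t := by
      intro hst
      obtain ⟨c, hc, hc0⟩ := exists_hasDerivAt_eq_zero (f := fun s => g s b)
        (f' := fun t => g' t b) hst
        (fun x _ => (hderiv x b).continuousAt.continuousWithinAt) he (fun x _ => hderiv x b)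
      exact hb c ⟨hs.1.le.trans hc.1.le, hc.2.le.trans ht.2.le⟩ hc0
    rintro ⟨s, b⟩ ⟨hs, hb⟩ ⟨t, c⟩ ⟨ht, -⟩ he
    obtain ⟨he, rfl⟩ := Prod.mk.inj he
    exact Prod.ext (le_antisymm (not_lt.1 (key ht hs hb he.symm)) (not_lt.1 (key hs ht hb he))) rfl
  refine ⟨disjointed B, fun k => .disjointed hBm k, disjoint_disjointed B, ?_,
    fun k => (hBinj k).mono (disjointed_subset B k)⟩
  rw [iUnion_disjointed]
  ext ⟨t, b⟩
  simp only [mem_iUnion, mem_ofPred_eq]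
  constructor
  · rintro ⟨k, ht, hb⟩
    exact hb t ⟨ht.1.le, ht.2.le⟩
  · intro h
    have hnhds : {s | g' s b ≠ 0} ∈ nhds t :=
      (isOpen_ne_fun (hg'.comp (by fun_prop : Continuous fun s : ℝ => (s, b)))
        continuous_const).mem_nhds h
    obtain ⟨ε, hε, hball⟩ := Metric.mem_nhds_iff.1 hnhds
    obtain ⟨p, hp1, hp2⟩ := exists_rat_btwn (sub_lt_self t hε)
    obtain ⟨q, hq1, hq2⟩ := exists_rat_btwn (lt_add_of_pos_right t hε)
    obtain ⟨k, hk⟩ := hr (p, q)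
    refine ⟨k, ?_, fun s hs => hball ?_⟩ <;> simp only [hk] at *
    · exact ⟨hp2, hq1⟩
    · rw [Real.ball_eq_Ioo]
      exact ⟨hp1.trans_le hs.1, hs.2.trans_lt hq2⟩

section ParametricArea

variable {E : Type*} [TopologicalSpace E] [PolishSpace E] [MeasurableSpace E] [BorelSpace E]
  {g g' : ℝ → E → ℝ}

/-- The critical values of a continuously parametrised family of functions form a null set. -/
theorem prod_image_critical_eq_zero [SigmaCompactSpace E] (ν : Measure E) [SFinite ν]
    (φ : ℝ → ℝ≥0∞)
    (hg : Continuous fun p : ℝ × E => g p.1 p.2) (hg' : Continuous fun p : ℝ × E => g' p.1 p.2)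
    (hderiv : ∀ t b, HasDerivAt (fun s => g s b) (g' t b) t) :
    (((volume : Measure ℝ).withDensity φ).prod ν)
      ((fun p : ℝ × E => (g p.1 p.2, p.2)) '' {p | g' p.1 p.2 = 0}) = 0 := by
  have hΨ : Continuous fun p : ℝ × E => (g p.1 p.2, p.2) := hg.prodMk continuous_snd
  have hC : IsClosed {p : ℝ × E | g' p.1 p.2 = 0} := isClosed_eq hg' continuous_const
  have hm : MeasurableSet ((fun p : ℝ × E => (g p.1 p.2, p.2)) '' {p | g' p.1 p.2 = 0}) := by
    obtain ⟨K, hK, hKU⟩ := (isSigmaCompact_univ.of_isClosed_subset hC (subset_univ _)).image hΨ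
    rw [← hKU]
    exact MeasurableSet.iUnion fun n => (hK n).isClosed.measurableSet
  rw [Measure.prod_apply_symm hm]
  refine lintegral_eq_zero_of_ae_eq_zero (ae_of_all _ fun b => ?_)
  refine withDensity_absolutelyContinuous _ _ (measure_mono_null (t :=
    (fun t => g t b) '' {t | g' t b = 0}) ?_ ?_)
  · rintro y ⟨⟨t, c⟩, h, he⟩
    obtain ⟨rfl, rfl⟩ := Prod.mk.inj he
    exact ⟨t, h, rfl⟩
  · refine addHaar_image_eq_zero_of_det_fderivWithin_eq_zero volume
      (fun t _ => (hderiv t b).hasFDerivAt.hasFDerivWithinAt) fun t ht => ?_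
    simpa using ht

/-- The area formula with multiplicity for a random level of a random function: the
expected number of points of `I` at which `g · b` takes the value `y`. -/
theorem lintegral_encard_level_eq [SigmaCompactSpace E] {ν : Measure E} [SFinite ν]
    {φ : ℝ → ℝ≥0∞} (hφ : Measurable φ)
    (hg : Continuous fun p : ℝ × E => g p.1 p.2) (hg' : Continuous fun p : ℝ × E => g' p.1 p.2)
    (hderiv : ∀ t b, HasDerivAt (fun s => g s b) (g' t b) t) {I : Set ℝ} (hI : MeasurableSet I) :
    ∫⁻ q : ℝ × E, ({t | t ∈ I ∧ g t q.2 = q.1}.encard : ℝ≥0∞)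
        ∂(((volume : Measure ℝ).withDensity φ).prod ν)
      = ∫⁻ t in I, ∫⁻ b, ENNReal.ofReal |g' t b| * φ (g t b) ∂ν := by
  obtain ⟨A, hAm, hAd, hAU, hAinj⟩ := exists_measurable_injOn_partition hg' hderiv
  have hΨ : Measurable fun p : ℝ × E => (g p.1 p.2, p.2) := by
    have := hg.measurable
    fun_prop
  set D : ℕ → Set (ℝ × E) := fun k => A k ∩ I ×ˢ univ with hD
  have hDm (k : ℕ) : MeasurableSet (D k) := (hAm k).inter (hI.prod .univ)
  have hDinj (k : ℕ) := (hAinj k).mono (inter_subset_left (t := I ×ˢ univ))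
  have hDd : Pairwise (Function.onFun Disjoint D) := fun i j hij =>
    (hAd hij).mono inter_subset_left inter_subset_left
  have hDim (k : ℕ) := (hDm k).image_of_measurable_injOn hΨ (hDinj k)
  have hmeas : Measurable fun p : ℝ × E => ENNReal.ofReal |g' p.1 p.2| * φ (g p.1 p.2) := by
    have := hg.measurable
    have := hg'.measurable
    fun_prop
  have hcount : ∀ᵐ q ∂(((volume : Measure ℝ).withDensity φ).prod ν),
      ({t | t ∈ I ∧ g t q.2 = q.1}.encard : ℝ≥0∞)
        = ∑' k, ((fun p : ℝ × E => (g p.1 p.2, p.2)) '' D k).indicator 1 q := by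
    have hnull := prod_image_critical_eq_zero ν φ hg hg' hderiv
    filter_upwards [measure_eq_zero_iff_ae_notMem.1 hnull] with q hq
    have hclosed : IsClosed {t | g t q.2 = q.1} :=
      isClosed_eq (hg.comp (by fun_prop : Continuous fun s : ℝ => (s, q.2))) continuous_const
    have hset : {t | t ∈ I ∧ g t q.2 = q.1}
        = ⋃ k, {t | g t q.2 = q.1} ∩ (fun t => (t, q.2)) ⁻¹' D k := by
      ext t
      simp only [mem_ofPred_eq, mem_iUnion, mem_inter_iff, mem_preimage, hD, mem_prod, mem_univ,
        and_true, exists_and_left, exists_and_right]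
      rw [and_comm]
      refine and_congr_right fun ht => ⟨fun h => ⟨?_, h⟩, fun h => h.2⟩
      rw [← mem_iUnion, hAU]
      exact fun h0 => hq ⟨(t, q.2), h0, Prod.ext ht rfl⟩
    have hpm (k : ℕ) : MeasurableSet ({t | g t q.2 = q.1} ∩ (fun t => (t, q.2)) ⁻¹' D k) :=
      hclosed.measurableSet.inter (measurable_prodMk_right (hDm k))
    rw [hset, ← Measure.count_apply (MeasurableSet.iUnion hpm), measure_iUnion _ hpm]
    · refine tsum_congr fun k => ?_
      rw [Measure.count_apply (hpm k)]
      by_cases hk : q ∈ (fun p : ℝ × E => (g p.1 p.2, p.2)) '' D k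
      · rw [indicator_of_mem hk]
        obtain ⟨⟨t, b⟩, ht, rfl⟩ := hk
        have : {s | g s b = g t b} ∩ (fun s => (s, b)) ⁻¹' D k = {t} := by
          ext s
          constructor
          · rintro ⟨hs, hs'⟩
            exact (Prod.mk.inj (hDinj k hs' ht (Prod.ext hs rfl))).1
          · rintro rfl
            exact ⟨rfl, ht⟩
        simp [this]
      · rw [indicator_of_notMem hk]
        have : {s | g s q.2 = q.1} ∩ (fun s => (s, q.2)) ⁻¹' D k = ∅ := by
          ext s
          simp only [mem_inter_iff, mem_empty_iff_false, iff_false]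
          rintro ⟨hs, hs'⟩
          exact hk ⟨_, hs', Prod.ext hs rfl⟩
        simp [this]
    · intro i j hij
      exact ((hDd hij).preimage _).mono inter_subset_right inter_subset_right
  rw [lintegral_congr_ae hcount,
    lintegral_tsum fun k => (measurable_one.indicator (hDim k)).aemeasurable]
  simp_rw [lintegral_indicator_one (hDim _), prod_image_eq_lintegral_abs_deriv hφ hg.measurable
    hg'.measurable hderiv (hDm _) (hDinj _) (hDim _)]
  rw [← lintegral_iUnion hDm hDd, ← iUnion_inter, hAU]
  have hIm : MeasurableSet (I ×ˢ (univ : Set E)) := hI.prod .univ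
  calc
    _ = ∫⁻ p in I ×ˢ univ, ENNReal.ofReal |g' p.1 p.2| * φ (g p.1 p.2)
          ∂((volume : Measure ℝ).prod ν) := by
      rw [← lintegral_indicator hIm, ← lintegral_indicator
        ((isOpen_ne_fun hg' continuous_const).measurableSet.inter hIm)]
      refine lintegral_congr fun p => ?_
      by_cases hp : g' p.1 p.2 = 0 <;> by_cases hpI : p.1 ∈ I <;> simp [indicator, hp, hpI]
    _ = _ := by
      rw [← Measure.prod_restrict, Measure.restrict_univ, lintegral_prod _ hmeas.aemeasurable]

end ParametricArea

/-- Tilting a centered Gaussian by the standard Gaussian density. -/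
theorem lintegral_mul_gaussianPDF_gaussianReal {v : ℝ≥0} (hv : v ≠ 0) {F : ℝ → ℝ≥0∞}
    (hF : Measurable F) :
    ∫⁻ u, F u * gaussianPDF 0 1 u ∂(gaussianReal 0 v)
      = ENNReal.ofReal (√(2 * π * (1 + v)))⁻¹ * ∫⁻ u, F u ∂(gaussianReal 0 (v / (1 + v))) := by
  have hv' : (0 : ℝ) < v := by positivity
  have hw : v / (1 + v) ≠ 0 := by positivity
  have hm : Measurable fun u => F u * gaussianPDF 0 1 u := hF.mul (measurable_gaussianPDF _ _)
  rw [gaussianReal_of_var_ne_zero _ hv, gaussianReal_of_var_ne_zero _ hw,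
    lintegral_withDensity_eq_lintegral_mul _ (measurable_gaussianPDF _ _) hm,
    lintegral_withDensity_eq_lintegral_mul _ (measurable_gaussianPDF _ _) hF,
    ← lintegral_const_mul _ ((measurable_gaussianPDF _ _).mul hF)]
  refine lintegral_congr fun u => ?_
  simp only [Pi.mul_apply, gaussianPDF]
  rw [mul_left_comm, mul_comm, ← mul_assoc, ← ENNReal.ofReal_mul (gaussianPDFReal_nonneg _ _ _),
    ← ENNReal.ofReal_mul (by positivity)]
  congr 2
  simp only [gaussianPDFReal]
  have e : rexp (-(u - 0) ^ 2 / (2 * (v : ℝ))) * rexp (-(u - 0) ^ 2 / (2 * ((1 : ℝ≥0) : ℝ)))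
      = rexp (-(u - 0) ^ 2 / (2 * ((v / (1 + v) : ℝ≥0) : ℝ))) := by
    rw [← Real.exp_add]
    congr 1
    push_cast
    field_simp
    ring
  have f : (√(2 * π * v))⁻¹ * (√(2 * π * ((1 : ℝ≥0) : ℝ)))⁻¹
      = (√(2 * π * (1 + v)))⁻¹ * (√(2 * π * ((v / (1 + v) : ℝ≥0) : ℝ)))⁻¹ := by
    rw [← mul_inv, ← mul_inv, ← sqrt_mul (by positivity), ← sqrt_mul (by positivity)]
    congr 2
    push_cast
    field_simp
  rw [mul_mul_mul_comm, e, f, mul_assoc]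

/-- The Kac–Rice integrand of a jointly Gaussian centered pair. -/
theorem lintegral_abs_mul_gaussianPDF {Ω : Type*} [MeasurableSpace Ω] {P : Measure Ω}
    {U V : Ω → ℝ} (h : HasGaussianLaw (fun ω => (U ω, V ω)) P)
    (hU : P[U] = 0) (hV : P[V] = 0) (ha : Var[U; P] ≠ 0) :
    ∫⁻ ω, ENNReal.ofReal |V ω| * gaussianPDF 0 1 (U ω) ∂P
      = ENNReal.ofReal (√(Var[V; P] * (1 + Var[U; P]) - cov[U, V; P] ^ 2)
          / (π * (1 + Var[U; P]))) := by
  have := h.isProbabilityMeasure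
  set a := Var[U; P] with ha_def
  set c := cov[U, V; P] with hc_def
  have ha0 : 0 < a := lt_of_le_of_ne (variance_nonneg _ _) ha.symm
  set W : Ω → ℝ := fun ω => V ω - c / a * U ω with hW
  have hUW : HasGaussianLaw (fun ω => (U ω, W ω)) P :=
    h.map_fun ((ContinuousLinearMap.fst ℝ ℝ ℝ).prod
      (ContinuousLinearMap.snd ℝ ℝ ℝ - (c / a) • ContinuousLinearMap.fst ℝ ℝ ℝ))
  have hU2 := h.fst.memLp_two
  have hV2 := h.snd.memLp_two
  have hcU2 : MemLp (fun ω => c / a * U ω) 2 P := hU2.const_mul _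
  have hcov : cov[U, W; P] = 0 := by
    rw [hW, covariance_fun_sub_right hU2 hV2 hcU2, covariance_const_mul_right,
      covariance_self h.fst.aemeasurable, ← ha_def, ← hc_def]
    field_simp
    ring
  have hWvar : Var[W; P] = Var[V; P] - c ^ 2 / a := by
    rw [hW, variance_fun_sub hV2 hcU2, variance_const_mul, covariance_const_mul_right,
      covariance_comm, ← ha_def, ← hc_def]
    field_simp
    ring
  have hWmean : P[W] = 0 := by
    rw [hW, integral_sub h.snd.integrable (h.fst.integrable.const_mul _), integral_const_mul,
      hU, hV]
    simp
  have hind := hUW.indepFun_of_covariance_eq_zero hcov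
  have hmap : P.map (fun ω => (U ω, W ω))
      = (gaussianReal 0 a.toNNReal).prod (gaussianReal 0 Var[W; P].toNNReal) := by
    rw [(indepFun_iff_map_prod_eq_prod_map_map hUW.fst.aemeasurable hUW.snd.aemeasurable).1 hind,
      hUW.fst.map_eq_gaussianReal, hUW.snd.map_eq_gaussianReal, hU, hWmean]
  have hpdf : Measurable (gaussianPDF 0 1) := measurable_gaussianPDF _ _
  have hmeas : Measurable fun p : ℝ × ℝ =>
      ENNReal.ofReal |c / a * p.1 + p.2| * gaussianPDF 0 1 p.1 := by fun_prop
  have hat : a.toNNReal ≠ 0 := by simpa using ha0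
  have haR : ((a.toNNReal : ℝ≥0) : ℝ) = a := Real.coe_toNNReal _ ha0.le
  calc
    _ = ∫⁻ ω, (fun p : ℝ × ℝ => ENNReal.ofReal |c / a * p.1 + p.2| * gaussianPDF 0 1 p.1)
          (U ω, W ω) ∂P := by
      refine lintegral_congr fun ω => ?_
      simp [hW]
    _ = ∫⁻ w, ∫⁻ u, ENNReal.ofReal |c / a * u + w| * gaussianPDF 0 1 u
          ∂(gaussianReal 0 a.toNNReal) ∂(gaussianReal 0 Var[W; P].toNNReal) := by
      rw [← lintegral_map' hmeas.aemeasurable hUW.aemeasurable, hmap, lintegral_prod_symm' _ hmeas]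
    _ = ENNReal.ofReal (√(2 * π * (1 + a)))⁻¹ * ∫⁻ w, ∫⁻ x, ENNReal.ofReal |x + w|
          ∂((gaussianReal 0 (a.toNNReal / (1 + a.toNNReal))).map (c / a * ·))
          ∂(gaussianReal 0 Var[W; P].toNNReal) := by
      have hm2 (w : ℝ) : Measurable fun x : ℝ => ENNReal.ofReal |x + w| := by fun_prop
      rw [← lintegral_const_mul]
      · refine lintegral_congr fun w => ?_
        rw [lintegral_mul_gaussianPDF_gaussianReal hat (by fun_prop), haR,
          lintegral_map (hm2 w) (by fun_prop)]
      · have : Measurable fun p : ℝ × ℝ => ENNReal.ofReal |p.2 + p.1| := by fun_prop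
        exact this.lintegral_prod_right'
    _ = ENNReal.ofReal (√(2 * π * (1 + a)))⁻¹ * ∫⁻ x, ENNReal.ofReal |x|
          ∂(((gaussianReal 0 (a.toNNReal / (1 + a.toNNReal))).map (c / a * ·)).conv
          (gaussianReal 0 Var[W; P].toNNReal)) := by
      have : Measurable fun p : ℝ × ℝ => ENNReal.ofReal |p.1 + p.2| := by fun_prop
      rw [Measure.lintegral_conv (by fun_prop), lintegral_lintegral_swap]
      exact (this.comp measurable_swap).aemeasurable
    _ = _ := by
      rw [gaussianReal_map_const_mul, gaussianReal_conv_gaussianReal, mul_zero, add_zero,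
        lintegral_abs_gaussianReal, ← ENNReal.ofReal_mul (by positivity)]
      congr 1
      have hW0 : 0 ≤ Var[W; P] := variance_nonneg _ _
      push_cast
      rw [Real.coe_toNNReal _ hW0, haR, hWvar, eq_div_iff (by positivity), ← sqrt_inv,
        ← sqrt_mul (by positivity), ← sqrt_sq (by positivity : 0 ≤ π * (1 + a)),
        ← sqrt_mul (by rw [← hWvar]; positivity)]
      congr 1
      field_simp
      ring

section PiGaussian

variable {ι : Type*} [Fintype ι] (v : ι → ℝ≥0)

/-- Two linear forms in independent Gaussians are jointly Gaussian. -/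
theorem hasGaussianLaw_pair_sum (x y : ι → ℝ) :
    HasGaussianLaw (fun b : ι → ℝ => (∑ i, x i * b i, ∑ i, y i * b i))
      (Measure.pi fun i => gaussianReal 0 (v i)) := by
  have h : HasGaussianLaw (fun b : ι → ℝ => (b ·)) (Measure.pi fun i => gaussianReal 0 (v i)) := by
    refine iIndepFun.hasGaussianLaw (X := fun i (b : ι → ℝ) => b i) (fun i => ?_)
      (iIndepFun_pi (X := fun _ => id) fun i => aemeasurable_id)
    exact HasLaw.hasGaussianLaw
      ⟨(measurable_pi_apply i).aemeasurable,
        (measurePreserving_eval (fun i => gaussianReal 0 (v i)) i).map_eq⟩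
  have := h.map_fun ((∑ i, x i • ContinuousLinearMap.proj (R := ℝ) (φ := fun _ : ι => ℝ) i).prod
    (∑ i, y i • ContinuousLinearMap.proj (R := ℝ) (φ := fun _ : ι => ℝ) i))
  simpa using this

/-- Linear forms in centered independent Gaussians are centered. -/
theorem integral_sum_mul_pi_gaussianReal (x : ι → ℝ) :
    ∫ b : ι → ℝ, ∑ i, x i * b i ∂(Measure.pi fun i => gaussianReal 0 (v i)) = 0 := by
  have hmp (i : ι) := measurePreserving_eval (fun i => gaussianReal 0 (v i)) i
  have hi (i : ι) : Integrable (fun b : ι → ℝ => b i) (Measure.pi fun i => gaussianReal 0 (v i)) :=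
    (hmp i).integrable_comp_of_integrable
      ((memLp_id_gaussianReal (μ := 0) (v := v i) 1).integrable le_rfl)
  rw [integral_finsetSum _ fun i _ => (hi i).const_mul _]
  refine Finset.sum_eq_zero fun i _ => ?_
  rw [integral_const_mul]
  have : ∫ b : ι → ℝ, b i ∂(Measure.pi fun i => gaussianReal 0 (v i)) = 0 := by
    have h := integral_map (μ := Measure.pi fun i => gaussianReal 0 (v i)) (hmp i).aemeasurable
      (f := id) (by fun_prop)
    rw [(hmp i).map_eq] at h
    simpa using h.symm
  rw [this, mul_zero]

/-- The covariance of two linear forms in independent Gaussians. -/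
theorem covariance_sum_mul_pi_gaussianReal (x y : ι → ℝ) :
    cov[fun b : ι → ℝ => ∑ i, x i * b i, fun b => ∑ i, y i * b i;
      Measure.pi fun i => gaussianReal 0 (v i)] = ∑ i, x i * y i * v i := by
  have hmp (i : ι) := measurePreserving_eval (fun i => gaussianReal 0 (v i)) i
  have hL (i : ι) : MemLp (fun b : ι → ℝ => b i) 2 (Measure.pi fun i => gaussianReal 0 (v i)) :=
    (memLp_id_gaussianReal (μ := 0) (v := v i) 2).comp_measurePreserving (hmp i)
  have hind : iIndepFun (fun i (b : ι → ℝ) => b i) (Measure.pi fun i => gaussianReal 0 (v i)) :=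
    iIndepFun_pi (X := fun _ => id) fun i => aemeasurable_id
  rw [covariance_fun_sum_fun_sum (fun i => (hL i).const_mul _) (fun i => (hL i).const_mul _)]
  refine Finset.sum_congr rfl fun i _ => ?_
  rw [Finset.sum_eq_single_of_mem i (Finset.mem_univ i)]
  · rw [covariance_const_mul_left, covariance_const_mul_right,
      covariance_self (measurable_pi_apply i).aemeasurable]
    have : Var[fun b : ι → ℝ => b i; Measure.pi fun i => gaussianReal 0 (v i)] = v i := by
      rw [← variance_id_gaussianReal (μ := 0) (v := v i), ← (hmp i).map_eq,
        variance_map aemeasurable_id (hmp i).aemeasurable]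
      rfl
    rw [this]
    ring
  · intro j _ hij
    rw [covariance_const_mul_left, covariance_const_mul_right,
      (hind.indepFun hij.symm).covariance_eq_zero (hL i) (hL j)]
    ring

end PiGaussian

section Binomial

variable (m : ℕ) (x : ℝ)

/-- The binomial theorem for `(1 + x) ^ m`. -/
theorem sum_choose_mul_pow :
    ∑ i ∈ Finset.range (m + 1), (m.choose i : ℝ) * x ^ i = (1 + x) ^ m := by
  rw [add_comm 1 x, add_pow]
  exact Finset.sum_congr rfl fun i _ => by ring

theorem sum_choose_mul_succ_mul_pow :
    (1 + x) * ∑ i ∈ Finset.range (m + 1), (m.choose i : ℝ) * (i + 1) * x ^ i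
      = (1 + x) ^ m * (1 + (m + 1) * x) := by
  have h : (1 + x) * ∑ i ∈ Finset.range (m + 1), (m.choose i : ℝ) * i * x ^ i
      = m * x * (1 + x) ^ m := by
    cases m with
    | zero => simp
    | succ k =>
      rw [Finset.sum_range_succ']
      have (i : ℕ) : ((k + 1).choose (i + 1) : ℝ) * ((i + 1 : ℕ) : ℝ) * x ^ (i + 1)
          = (k + 1) * x * ((k.choose i : ℝ) * x ^ i) := by
        have := congrArg (Nat.cast (R := ℝ)) (Nat.add_one_mul_choose_eq k i)
        push_cast at this ⊢
        rw [← this]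
        ring
      simp_rw [this]
      rw [← Finset.mul_sum, sum_choose_mul_pow]
      push_cast
      ring
  have e (i : ℕ) : (m.choose i : ℝ) * (i + 1) * x ^ i
      = (m.choose i : ℝ) * i * x ^ i + (m.choose i : ℝ) * x ^ i := by ring
  simp_rw [e]
  rw [Finset.sum_add_distrib, mul_add, h, sum_choose_mul_pow]
  ring

theorem sum_choose_succ_mul_sq (t : ℝ) :
    ∑ i : Fin (m + 1), -t ^ ((i : ℕ) + 1) * -t ^ ((i : ℕ) + 1) * ((m + 1).choose (i + 1) : ℝ)
      = (1 + t ^ 2) ^ (m + 1) - 1 := by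
  rw [← sum_choose_mul_pow, Finset.sum_range_succ',
    Fin.sum_univ_eq_sum_range
      fun i => -t ^ (i + 1) * -t ^ (i + 1) * ((m + 1).choose (i + 1) : ℝ)]
  simp only [Nat.choose_zero_right, pow_zero, Nat.cast_one, mul_one, add_sub_cancel_right]
  exact Finset.sum_congr rfl fun i _ => by ring

theorem sum_choose_succ_mul_deriv (t : ℝ) :
    ∑ i : Fin (m + 1), -t ^ ((i : ℕ) + 1) * -((i + 1) * t ^ (i : ℕ))
        * ((m + 1).choose (i + 1) : ℝ)
      = (m + 1) * t * (1 + t ^ 2) ^ m := by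
  rw [← sum_choose_mul_pow, Finset.mul_sum, Fin.sum_univ_eq_sum_range
      fun i => -t ^ (i + 1) * -((i + 1) * t ^ i) * ((m + 1).choose (i + 1) : ℝ)]
  refine Finset.sum_congr rfl fun i _ => ?_
  have := congrArg (Nat.cast (R := ℝ)) (Nat.add_one_mul_choose_eq m i)
  push_cast at this
  linear_combination (-t * (t ^ 2) ^ i) * this

theorem sum_choose_succ_mul_deriv_sq (t : ℝ) :
    (1 + t ^ 2) * ∑ i : Fin (m + 1), -((i + 1) * t ^ (i : ℕ)) * -((i + 1) * t ^ (i : ℕ))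
        * ((m + 1).choose (i + 1) : ℝ)
      = (m + 1) * (1 + t ^ 2) ^ m * (1 + (m + 1) * t ^ 2) := by
  rw [mul_assoc, ← sum_choose_mul_succ_mul_pow, mul_left_comm _ (1 + t ^ 2), Finset.mul_sum _ _
    ((m : ℝ) + 1), Fin.sum_univ_eq_sum_range
      fun i => -((i + 1) * t ^ i) * -((i + 1) * t ^ i) * ((m + 1).choose (i + 1) : ℝ)]
  congr 1
  refine Finset.sum_congr rfl fun i _ => ?_
  have := congrArg (Nat.cast (R := ℝ)) (Nat.add_one_mul_choose_eq m i)
  push_cast at this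
  linear_combination (-((i : ℝ) + 1) * (t ^ 2) ^ i) * this

end Binomial

/-- The density of zeros at a nonzero point. -/
theorem lintegral_binomial_density (m : ℕ) {t : ℝ} (ht : t ≠ 0) :
    ∫⁻ b : Fin (m + 1) → ℝ, ENNReal.ofReal |∑ i : Fin (m + 1), -((i + 1) * t ^ (i : ℕ)) * b i|
        * gaussianPDF 0 1 (∑ i : Fin (m + 1), -t ^ ((i : ℕ) + 1) * b i)
        ∂(Measure.pi fun i : Fin (m + 1) => gaussianReal 0 ((m + 1).choose (i + 1)))
      = ENNReal.ofReal (√((m + 1 : ℕ) : ℝ) / (π * (1 + t ^ 2))) := by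
  have h1 : 0 < 1 + t ^ 2 := by positivity
  set P := Measure.pi fun i : Fin (m + 1) => gaussianReal 0 ((m + 1).choose (i + 1)) with hP
  have hlaw := hasGaussianLaw_pair_sum
    (fun i : Fin (m + 1) => (((m + 1).choose (i + 1) : ℕ) : ℝ≥0))
    (fun i => -t ^ ((i : ℕ) + 1)) (fun i => -((i + 1) * t ^ (i : ℕ)))
  have hvarU : Var[fun b : Fin (m + 1) → ℝ => ∑ i : Fin (m + 1), -t ^ ((i : ℕ) + 1) * b i; P]
      = (1 + t ^ 2) ^ (m + 1) - 1 := by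
    rw [← covariance_self hlaw.fst.aemeasurable, covariance_sum_mul_pi_gaussianReal,
      ← sum_choose_succ_mul_sq]
    simp
  have hvarV : (1 + t ^ 2) * Var[fun b : Fin (m + 1) → ℝ =>
      ∑ i : Fin (m + 1), -((i + 1) * t ^ (i : ℕ)) * b i; P]
      = (m + 1) * (1 + t ^ 2) ^ m * (1 + (m + 1) * t ^ 2) := by
    rw [← covariance_self hlaw.snd.aemeasurable, covariance_sum_mul_pi_gaussianReal,
      ← sum_choose_succ_mul_deriv_sq]
    simp
  have hcov : cov[fun b : Fin (m + 1) → ℝ => ∑ i : Fin (m + 1), -t ^ ((i : ℕ) + 1) * b i,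
      fun b => ∑ i : Fin (m + 1), -((i + 1) * t ^ (i : ℕ)) * b i; P] = (m + 1) * t * (1 + t ^ 2) ^ m := by
    rw [covariance_sum_mul_pi_gaussianReal, ← sum_choose_succ_mul_deriv]
    simp
  rw [lintegral_abs_mul_gaussianPDF hlaw (integral_sum_mul_pi_gaussianReal _ _)
    (integral_sum_mul_pi_gaussianReal _ _), hvarU, hcov]
  · congr 1
    have e : Var[fun b : Fin (m + 1) → ℝ =>
        ∑ i : Fin (m + 1), -((i + 1) * t ^ (i : ℕ)) * b i; P]
          * (1 + t ^ 2) ^ (m + 1) - ((m + 1) * t * (1 + t ^ 2) ^ m) ^ 2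
        = ((m + 1 : ℕ) : ℝ) * ((1 + t ^ 2) ^ m) ^ 2 := by
      push_cast
      linear_combination (1 + t ^ 2) ^ m * hvarV
    rw [add_sub_cancel, e, sqrt_mul (by positivity), sqrt_sq (by positivity)]
    field_simp
    ring
  · rw [hvarU]
    have : 1 < (1 + t ^ 2) ^ (m + 1) :=
      one_lt_pow₀ (lt_add_of_pos_right 1 (by positivity)) (by omega)
    exact (sub_pos.2 this).ne'

/-- Section 3.1.2: for the random polynomial `p(x) = a₀ + a₁x + ⋯ + aₙxⁿ` whose
coefficients are independent centered normals with `Var(aᵢ) = C(n,i)`, the expected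
number of zeros in any measurable set `I` is `∫_I √n/(π(1+t²)) dt`; in particular the
expected total number of real zeros is `√n`. -/
theorem binomial_variance_polynomial (n : ℕ) (hn : 1 ≤ n) :
    (∀ I : Set ℝ, MeasurableSet I →
      ∫⁻ a : Fin (n + 1) → ℝ,
          ({t : ℝ | t ∈ I ∧ ∑ i : Fin (n + 1), a i * t ^ (i : ℕ) = 0}.encard : ℝ≥0∞)
          ∂(Measure.pi fun i : Fin (n + 1) => gaussianReal 0 (n.choose i))
        = ∫⁻ t in I, ENNReal.ofReal (Real.sqrt n / (π * (1 + t ^ 2)))) ∧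
    ∫⁻ a : Fin (n + 1) → ℝ,
        ({t : ℝ | ∑ i : Fin (n + 1), a i * t ^ (i : ℕ) = 0}.encard : ℝ≥0∞)
        ∂(Measure.pi fun i : Fin (n + 1) => gaussianReal 0 (n.choose i))
      = ENNReal.ofReal (Real.sqrt n) := by
  have main (I : Set ℝ) (hI : MeasurableSet I) :
      ∫⁻ a : Fin (n + 1) → ℝ,
          ({t : ℝ | t ∈ I ∧ ∑ i : Fin (n + 1), a i * t ^ (i : ℕ) = 0}.encard : ℝ≥0∞)
          ∂(Measure.pi fun i : Fin (n + 1) => gaussianReal 0 (n.choose i))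
        = ∫⁻ t in I, ENNReal.ofReal (Real.sqrt n / (π * (1 + t ^ 2))) := by
    obtain ⟨m, rfl⟩ := Nat.exists_eq_add_of_le' hn
    set P := Measure.pi fun i : Fin (m + 1) => gaussianReal 0 ((m + 1).choose (i + 1)) with hP
    have hmp := measurePreserving_piFinSuccAbove
      (fun i : Fin (m + 1 + 1) => gaussianReal 0 ((m + 1).choose i)) 0
    have hQ : (gaussianReal 0 ((m + 1).choose (0 : Fin (m + 1 + 1)))).prod
        (Measure.pi fun j : Fin (m + 1) => gaussianReal 0 ((m + 1).choose (Fin.succAbove 0 j)))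
        = ((volume : Measure ℝ).withDensity (gaussianPDF 0 1)).prod P := by
      rw [← gaussianReal_of_var_ne_zero _ one_ne_zero, hP]
      simp
    have harea := lintegral_encard_level_eq (ν := P)
      (g := fun t b => ∑ i : Fin (m + 1), -t ^ ((i : ℕ) + 1) * b i)
      (g' := fun t b => ∑ i : Fin (m + 1), -((i + 1) * t ^ (i : ℕ)) * b i)
      (measurable_gaussianPDF 0 1) (by fun_prop) (by fun_prop) (fun t b => by
        refine HasDerivAt.fun_sum fun i _ => ?_
        simpa using ((hasDerivAt_pow ((i : ℕ) + 1) t).neg.mul_const (b i))) hI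
    rw [← hQ, ← hmp.map_eq, lintegral_map_equiv] at harea
    calc
      _ = _ := lintegral_congr fun a => ?_
      _ = _ := harea
      _ = _ := ?_
    · congr 3
      ext t
      refine and_congr_right fun _ => ?_
      rw [Fin.sum_univ_succ]
      simp only [MeasurableEquiv.piFinSuccAbove, Fin.val_zero, pow_zero, mul_one, Fin.val_succ,
        neg_mul, Finset.sum_neg_distrib, MeasurableEquiv.coe_mk, Fin.insertNthEquiv_zero,
        Fin.consEquiv_symm_apply, Fin.tail]
      simp_rw [mul_comm (t ^ _)]
      rw [neg_eq_iff_add_eq_zero, add_comm]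
    · refine lintegral_congr_ae (ae_restrict_of_ae ?_)
      filter_upwards [Measure.ae_ne volume (0 : ℝ)] with t ht
      exact lintegral_binomial_density m ht
  refine ⟨main, ?_⟩
  have h := main univ .univ
  simp only [mem_univ, true_and, Measure.restrict_univ] at h
  rw [h]
  have e (t : ℝ) : √(n : ℝ) / (π * (1 + t ^ 2)) = √(n : ℝ) / π * (1 + t ^ 2)⁻¹ := by
    field_simp
  simp_rw [e]
  rw [← ofReal_integral_eq_lintegral_ofReal (integrable_inv_one_add_sq.const_mul _)
    (ae_of_all _ fun t => by positivity), integral_const_mul, integral_univ_inv_one_add_sq,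
    div_mul_cancel₀ _ pi_ne_zero]
end

section
/- For n ≥ 1, define the super-circle γ : ℝ → ℝ^(n+1) by γ_k(θ) = C(n,k)^(1/2) · (cos θ)^(n−k) · (sin θ)^k for k = 0, 1, …, n, where C(n,k) is the binomial coefficient. Then for every θ: (i) ‖γ(θ)‖ = 1, i.e., γ lies on the unit sphere S^n; and (ii) ‖γ′(θ)‖ = √n, i.e., γ has constant speed √n. (Section 4.1.) -/
/-- The binomial theorem gives the reproducing kernel of the super-circle. -/
theorem inner_superCircle {n : ℕ} {γ : ℝ → EuclideanSpace ℝ (Fin (n + 1))}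
    (hγ : ∀ θ (k : Fin (n + 1)), γ θ k
      = Real.sqrt (n.choose k) * Real.cos θ ^ (n - (k : ℕ)) * Real.sin θ ^ (k : ℕ)) (s t : ℝ) :
    inner ℝ (γ s) (γ t) = Real.cos (s - t) ^ n := by
  rw [Real.cos_sub, add_comm (Real.cos s * Real.cos t), add_pow, PiLp.inner_apply, Finset.sum_range]
  refine Finset.sum_congr rfl fun k _ => ?_
  have h : Real.sqrt (n.choose k) * Real.sqrt (n.choose k) = n.choose k :=
    Real.mul_self_sqrt (Nat.cast_nonneg _)
  simp only [hγ, RCLike.inner_apply, conj_trivial, mul_pow]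
  linear_combination
    (Real.cos s * Real.cos t) ^ (n - (k : ℕ)) * (Real.sin s * Real.sin t) ^ (k : ℕ) * h

theorem differentiable_superCircle {n : ℕ} {γ : ℝ → EuclideanSpace ℝ (Fin (n + 1))}
    (hγ : ∀ θ (k : Fin (n + 1)), γ θ k
      = Real.sqrt (n.choose k) * Real.cos θ ^ (n - (k : ℕ)) * Real.sin θ ^ (k : ℕ)) :
    Differentiable ℝ γ := by
  refine differentiable_euclidean.2 fun k => ?_
  simp only [hγ]
  fun_prop

/-- Section 4.1: the super-circle `γₖ(θ) = C(n,k)^{1/2} cosⁿ⁻ᵏθ sinᵏθ` lies on the unit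
sphere `Sⁿ` and is traced with constant speed `√n`. -/
theorem super_circle (n : ℕ) (hn : 1 ≤ n)
    (γ : ℝ → EuclideanSpace ℝ (Fin (n + 1)))
    (hγ : ∀ θ (k : Fin (n + 1)), γ θ k
      = Real.sqrt (n.choose k) * Real.cos θ ^ (n - (k : ℕ)) * Real.sin θ ^ (k : ℕ)) :
    ∀ θ : ℝ, ‖γ θ‖ = 1 ∧ ‖deriv γ θ‖ = Real.sqrt n := by
  intro θ
  have hd : HasDerivAt γ (deriv γ θ) θ := (differentiable_superCircle hγ θ).hasDerivAt
  have hfst (s : ℝ) : inner ℝ (γ s) (deriv γ θ)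
      = n * Real.cos (s - θ) ^ (n - 1) * Real.sin (s - θ) := by
    have h1 := (hasDerivAt_const θ (γ s)).inner ℝ hd
    have h2 := (((hasDerivAt_id θ).const_sub s).cos).pow n
    simp only [inner_superCircle hγ] at h1
    simpa using h1.unique h2
  have hsnd : inner ℝ (deriv γ θ) (deriv γ θ) = (n : ℝ) := by
    have h1 := hd.inner ℝ (hasDerivAt_const θ (deriv γ θ))
    have hs := (hasDerivAt_id θ).sub_const θ
    have h2 := ((hs.cos.pow (n - 1)).const_mul (n : ℝ)).mul hs.sin
    simp only [hfst] at h1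
    simpa using h1.unique h2
  constructor
  · rw [norm_eq_sqrt_real_inner, inner_superCircle hγ]
    simp
  · rw [norm_eq_sqrt_real_inner, hsnd]
end
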